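/- arXiv:2212.13713 — 7 statements merged into one kernel-verified Lean document; each statement's English description precedes it below -/
import Mathlib

section
/- The linear span H_{ReLU^k}(ℝ) of the functions x ↦ ReLU^k(ax+b), with a ≠ 0 and b ∈ ℝ, is dense in the normed space 𝒴_k(ℝ). Equivalently: for every f ∈ 𝒴_k(ℝ) and every ε > 0 there exist finitely many coefficients c_1,…,c_N ∈ ℝ, slopes a_1,…,a_N ∈ ℝ \ {0} and shifts b_1,…,b_N ∈ ℝ such that sup_{x∈ℝ} |f(x) − Σ_{j=1}^N c_j ReLU^k(a_j x + b_j)| / (1+|x|^k) < ε. -/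
open Filter

/-- A function that ramps from `0` to `1` over `[0, K]` approximates, by superposition of its
translates and dilates, every compactly supported continuous function uniformly. -/
lemma exists_ramp_sum_approx (h ρ : ℝ → ℝ) (S M : ℝ) (K : ℕ) (hh : Continuous h)
    (hS : ∀ x, S ≤ |x| → h x = 0) (hM : ∀ x, |ρ x| ≤ M) (h0 : ∀ x ≤ 0, ρ x = 0)
    (h1 : ∀ x : ℝ, K ≤ x → ρ x = 1) (ε : ℝ) (hε : 0 < ε) :
    ∃ (n : ℕ) (d : ℕ → ℝ) (δ s : ℝ), 0 < δ ∧
      ∀ x, |h x - ∑ j ∈ Finset.range n, d j * ρ ((x + s) / δ - j)| ≤ ε := by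
  have hM0 : 0 ≤ M := (abs_nonneg _).trans (hM 0)
  have huc : UniformContinuous h := by
    refine hh.uniformContinuous_of_tendsto_cocompact (x := 0) ?_
    refine tendsto_const_nhds.congr' ?_
    filter_upwards [(tendsto_norm_cocompact_atTop (E := ℝ)).eventually_ge_atTop S] with x hx
    exact (hS x hx).symm
  set η := ε / (1 + K * (M + 1)) with hη
  have hden : 0 < 1 + K * (M + 1) := by positivity
  have hη0 : 0 < η := by positivity
  obtain ⟨δ', hδ', hmod⟩ := Metric.uniformContinuous_iff.1 huc η hη0
  set δ := δ' / 2 with hδ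
  have hδ0 : 0 < δ := by positivity
  have hmod' : ∀ x y, |x - y| ≤ δ → |h x - h y| ≤ η := fun x y hxy =>
    (hmod (by rw [Real.dist_eq]; linarith : dist x y < δ')).le
  set t : ℕ → ℝ := fun j => -|S| + j * δ with ht
  obtain ⟨n, hn⟩ := exists_nat_ge (2 * |S| / δ)
  rw [div_le_iff₀ hδ0] at hn
  set d : ℕ → ℝ := fun j => h (t (j + 1)) - h (t j) with hd
  have ht0 : h (t 0) = 0 := hS _ (by simp [ht, le_abs_self])
  have htn : ∀ j, n ≤ j → h (t j) = 0 := fun j hj => by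
    have hj' : (n : ℝ) * δ ≤ j * δ := by gcongr
    refine hS _ ((le_abs_self S).trans (le_trans ?_ (le_abs_self _)))
    simp only [ht]; linarith
  have hd0 : ∀ j, n ≤ j → d j = 0 := fun j hj => by
    simp [hd, htn j hj, htn (j + 1) (by omega)]
  have hdη : ∀ j, |d j| ≤ η := fun j => hmod' _ _ (by
    simp only [ht]; push_cast; rw [abs_of_nonneg] <;> nlinarith)
  refine ⟨n, d, δ, |S|, hδ0, fun x => ?_⟩
  rcases lt_or_ge x (-|S|) with hx | hx
  · have hhx : h x = 0 := hS x (by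
      have := neg_le_abs x
      have := le_abs_self S
      linarith)
    rw [hhx, Finset.sum_eq_zero]
    · simpa using hε.le
    · intro j _
      rw [h0, mul_zero]
      have : (x + |S|) / δ ≤ 0 := div_nonpos_of_nonpos_of_nonneg (by linarith) hδ0.le
      have : (0 : ℝ) ≤ j := j.cast_nonneg
      linarith
  · set y := (x + |S|) / δ with hy
    have hy0 : 0 ≤ y := div_nonneg (by linarith) hδ0.le
    have hyx : x = -|S| + y * δ := by rw [hy]; field_simp; ring
    set m := ⌊y⌋₊ with hm
    have hm1 : (m : ℝ) ≤ y := Nat.floor_le hy0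
    have hm2 : y < m + 1 := Nat.lt_floor_add_one y
    have hsum : ∑ j ∈ Finset.range n, d j * ρ (y - j)
        = ∑ j ∈ Finset.range (m + 1), d j * ρ (y - j) := by
      trans ∑ j ∈ Finset.range (n + (m + 1)), d j * ρ (y - j)
      · refine Finset.sum_subset (Finset.range_mono (by omega)) fun j _ hj => ?_
        rw [hd0 j (by simpa using hj), zero_mul]
      · refine (Finset.sum_subset (Finset.range_mono (by omega)) fun j _ hj => ?_).symm
        have : (m : ℝ) + 1 ≤ j := by
          have : m + 1 ≤ j := by simpa using hj
          exact_mod_cast this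
        rw [h0 _ (by linarith), mul_zero]
    have htel : ∑ j ∈ Finset.range (m + 1), d j = h (t (m + 1)) := by
      rw [Finset.sum_range_sub (fun j => h (t j)), ht0, sub_zero]
    have hx1 : |h x - h (t (m + 1))| ≤ η := hmod' _ _ (by
      simp only [ht]; push_cast; rw [hyx, abs_le]; constructor <;> nlinarith)
    have hx2 : |∑ j ∈ Finset.range (m + 1), d j * (1 - ρ (y - j))| ≤ K * (η * (M + 1)) := by
      calc _ ≤ ∑ j ∈ Finset.range (m + 1), |d j * (1 - ρ (y - j))| :=
            Finset.abs_sum_le_sum_abs _ _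
        _ ≤ ∑ j ∈ Finset.range (m + 1), if m < j + K then η * (M + 1) else 0 := by
            refine Finset.sum_le_sum fun j _ => ?_
            split_ifs with hj
            · rw [abs_mul]
              refine mul_le_mul (hdη j) ?_ (abs_nonneg _) hη0.le
              have := abs_le.1 (hM (y - j))
              rw [abs_le]; constructor <;> linarith
            · have : (j : ℝ) + K ≤ m := by exact_mod_cast not_lt.1 hj
              rw [h1 _ (by linarith)]; simp
        _ ≤ K * (η * (M + 1)) := by
            rw [← Finset.sum_filter, Finset.sum_const, nsmul_eq_mul]
            have hc : ((Finset.range (m + 1)).filter fun j => m < j + K).card ≤ K := by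
              refine (Finset.card_le_card
                (t := Finset.Ico (m + 1 - K) (m + 1)) fun j hj => ?_).trans ?_
              · simp only [Finset.mem_filter, Finset.mem_range, Finset.mem_Ico] at hj ⊢
                omega
              · rw [Nat.card_Ico]; omega
            have hc' : (((Finset.range (m + 1)).filter fun j => m < j + K).card : ℝ) ≤ K := by
              exact_mod_cast hc
            exact mul_le_mul_of_nonneg_right hc' (by positivity)
    have hsplit : h x - ∑ j ∈ Finset.range n, d j * ρ (y - j)
        = (h x - h (t (m + 1))) + ∑ j ∈ Finset.range (m + 1), d j * (1 - ρ (y - j)) := by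
      rw [hsum, ← htel]
      simp only [mul_sub, mul_one, Finset.sum_sub_distrib]
      ring
    rw [hsplit]
    refine (abs_add_le _ _).trans ((add_le_add hx1 hx2).trans (le_of_eq ?_))
    rw [hη]; field_simp

/-- The linear span of the functions `x ↦ ReLU^k(a x + b)` with `a ≠ 0`. -/
def reluSpan (k : ℕ) : Submodule ℝ (ℝ → ℝ) :=
  Submodule.span ℝ {φ | ∃ a b : ℝ, a ≠ 0 ∧ φ = fun x => max (a * x + b) 0 ^ k}

lemma relu_mem_reluSpan (k : ℕ) {a : ℝ} (ha : a ≠ 0) (b : ℝ) :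
    (fun x : ℝ => max (a * x + b) 0 ^ k) ∈ reluSpan k :=
  Submodule.subset_span ⟨a, b, ha, rfl⟩

lemma comp_affine_mem_reluSpan {k : ℕ} {φ : ℝ → ℝ} (hφ : φ ∈ reluSpan k) {a : ℝ} (ha : a ≠ 0)
    (b : ℝ) : (fun x => φ (a * x + b)) ∈ reluSpan k := by
  induction hφ using Submodule.span_induction with
  | mem φ hφ =>
    obtain ⟨a', b', ha', rfl⟩ := hφ
    convert relu_mem_reluSpan k (mul_ne_zero ha' ha) (a' * b + b') using 4
    ring
  | zero => exact (reluSpan k).zero_mem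
  | add φ ψ _ _ hφ hψ => exact (reluSpan k).add_mem hφ hψ
  | smul c φ _ hφ => exact (reluSpan k).smul_mem c hφ

/-- The span contains a bounded ramp, obtained as a `k`-th finite difference. -/
lemma exists_ramp_mem_reluSpan (k : ℕ) (hk : 1 ≤ k) :
    ∃ ρ ∈ reluSpan k, (∃ M, ∀ x, |ρ x| ≤ M) ∧ (∀ x ≤ 0, ρ x = 0) ∧
      ∀ x : ℝ, k ≤ x → ρ x = 1 := by
  set ρ : ℝ → ℝ := fun x => ∑ i ∈ Finset.range (k + 1),
    ((k.factorial : ℝ)⁻¹ * ((-1) ^ (k - i) * k.choose i)) * max (1 * x + (i - k)) 0 ^ k with hρ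
  have h0 : ∀ x ≤ 0, ρ x = 0 := fun x hx => by
    refine Finset.sum_eq_zero fun i hi => ?_
    have : (i : ℝ) ≤ k := by
      have := Finset.mem_range.1 hi
      exact_mod_cast (by omega : i ≤ k)
    rw [max_eq_right (by linarith), zero_pow (by omega), mul_zero]
  have h1 : ∀ x : ℝ, k ≤ x → ρ x = 1 := fun x hx => by
    have key := fwdDiff_iter_eq_sum_shift (1 : ℝ) (fun r : ℝ => r ^ k) k (x - k)
    rw [fwdDiff_iter_eq_factorial] at key
    have hf : (k.factorial : ℝ) ≠ 0 := by positivity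
    have : ρ x = (k.factorial : ℝ)⁻¹ * k.factorial := by
      have key' : (k.factorial : ℝ) = ∑ i ∈ Finset.range (k + 1),
          (-1) ^ (k - i) * (k.choose i : ℝ) * (x - k + i) ^ k := by simpa using key
      refine Eq.trans ?_ (congrArg ((k.factorial : ℝ)⁻¹ * ·) key').symm
      simp only [hρ, Finset.mul_sum]
      refine Finset.sum_congr rfl fun i _ => ?_
      rw [max_eq_left (by have : (0 : ℝ) ≤ i := i.cast_nonneg
                          linarith)]
      ring
    rw [this, inv_mul_cancel₀ hf]
  refine ⟨ρ, ?_, ?_, h0, h1⟩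
  · have : ρ = ∑ i ∈ Finset.range (k + 1),
        ((k.factorial : ℝ)⁻¹ * ((-1) ^ (k - i) * k.choose i)) •
          fun x : ℝ => max (1 * x + ((i : ℝ) - k)) 0 ^ k := by
      ext x; simp [hρ]
    rw [this]
    exact Submodule.sum_mem _ fun i _ =>
      Submodule.smul_mem _ _ (relu_mem_reluSpan k one_ne_zero _)
  · have hc : Continuous ρ := by fun_prop
    obtain ⟨C, hC⟩ := (isCompact_Icc (a := (0 : ℝ)) (b := k)).exists_bound_of_continuousOn
      hc.continuousOn
    refine ⟨max C 1, fun x => ?_⟩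
    rcases le_total x 0 with hx | hx
    · rw [h0 x hx]; simp
    rcases le_total x k with hx' | hx'
    · exact (hC x ⟨hx, hx'⟩).trans (le_max_left _ _)
    · rw [h1 x hx']; simp

/-- Compactly supported continuous functions are uniform limits of elements of the span. -/
lemma exists_mem_reluSpan_approx (k : ℕ) (hk : 1 ≤ k) (h : ℝ → ℝ) (S : ℝ) (hh : Continuous h)
    (hS : ∀ x, S ≤ |x| → h x = 0) (ε : ℝ) (hε : 0 < ε) :
    ∃ φ ∈ reluSpan k, ∀ x, |h x - φ x| ≤ ε := by
  obtain ⟨ρ, hρ, ⟨M, hM⟩, h0, h1⟩ := exists_ramp_mem_reluSpan k hk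
  obtain ⟨n, d, δ, s, hδ, happ⟩ := exists_ramp_sum_approx h ρ S M k hh hS hM h0 h1 ε hε
  refine ⟨∑ j ∈ Finset.range n, d j • fun x => ρ (δ⁻¹ * x + (δ⁻¹ * s - j)), ?_, fun x => ?_⟩
  · exact Submodule.sum_mem _ fun j _ =>
      Submodule.smul_mem _ _ (comp_affine_mem_reluSpan hρ (inv_ne_zero hδ.ne') _)
  · convert happ x using 3
    simp only [Finset.sum_apply, Pi.smul_apply, smul_eq_mul]
    refine Finset.sum_congr rfl fun j _ => ?_
    congr 2
    ring

lemma tendsto_sub_relu_div (k : ℕ) (hk : 1 ≤ k) (f : ℝ → ℝ) (L L' : ℝ)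
    (hf : Tendsto (fun x : ℝ => f x / (1 + |x| ^ k)) atTop (nhds L)) :
    Tendsto (fun x : ℝ => (f x - L * max x 0 ^ k - L' * max (-x) 0 ^ k) / (1 + |x| ^ k))
      atTop (nhds 0) := by
  have h1 : Tendsto (fun x : ℝ => L / (1 + |x| ^ k)) atTop (nhds 0) :=
    tendsto_const_nhds.div_atTop (tendsto_atTop_add_const_left _ _
      ((tendsto_pow_atTop (by omega)).comp tendsto_abs_atTop_atTop))
  have h2 := (hf.sub_const L).add h1
  rw [sub_self, zero_add] at h2
  refine h2.congr' ?_
  filter_upwards [eventually_ge_atTop 0] with x hx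
  have : 0 < 1 + x ^ k := by positivity
  rw [max_eq_left hx, max_eq_right (by linarith), zero_pow (by omega), abs_of_nonneg hx]
  field_simp
  ring

/-- Global universality of two-layer networks with `k`-ReLU activation:
the span of `x ↦ ReLU^k(a x + b)` (`a ≠ 0`) is dense in `𝒴_k(ℝ)`. -/
theorem releuk_span_dense_in_Yk (k : ℕ) (hk : 1 ≤ k) (f : ℝ → ℝ)
    (hf_cont : Continuous f)
    (hf_top : ∃ L : ℝ, Tendsto (fun x : ℝ => f x / (1 + |x| ^ k)) atTop (nhds L))
    (hf_bot : ∃ L : ℝ, Tendsto (fun x : ℝ => f x / (1 + |x| ^ k)) atBot (nhds L))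
    (ε : ℝ) (hε : 0 < ε) :
    ∃ (N : ℕ) (c a b : Fin N → ℝ), (∀ j, a j ≠ 0) ∧
      (⨆ x : ℝ, |f x - ∑ j, c j * max (a j * x + b j) 0 ^ k| / (1 + |x| ^ k)) < ε := by
  obtain ⟨Lp, hLp⟩ := hf_top
  obtain ⟨Lm, hLm⟩ := hf_bot
  set g : ℝ → ℝ := fun x => f x - Lp * max x 0 ^ k - Lm * max (-x) 0 ^ k with hg
  have hw : ∀ x : ℝ, 0 < 1 + |x| ^ k := fun x => by positivity
  have hgc : Continuous g := by fun_prop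
  have htop : Tendsto (fun x => g x / (1 + |x| ^ k)) atTop (nhds 0) :=
    tendsto_sub_relu_div k hk f Lp Lm hLp
  have hbot : Tendsto (fun x => g (-x) / (1 + |x| ^ k)) atTop (nhds 0) := by
    have := tendsto_sub_relu_div k hk (fun x => f (-x)) Lm Lp
      (by simpa [Function.comp_def] using hLm.comp tendsto_neg_atTop_atBot)
    refine this.congr fun x => ?_
    simp only [hg, neg_neg]
    ring
  obtain ⟨R, hR⟩ := eventually_atTop.1
    ((Metric.tendsto_nhds.1 htop (ε / 4) (by positivity)).and
      (Metric.tendsto_nhds.1 hbot (ε / 4) (by positivity)))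
  have hgR : ∀ x, R ≤ |x| → |g x| ≤ ε / 4 * (1 + |x| ^ k) := fun x hx => by
    rw [← div_le_iff₀ (hw x)]
    obtain ⟨h1, h2⟩ := hR _ hx
    simp only [Real.dist_eq, sub_zero, abs_div, abs_abs, abs_of_pos (hw x)] at h1 h2
    rcases abs_choice x with h | h
    · rw [h] at h1 ⊢; exact h1.le
    · rw [h] at h2 ⊢; rw [neg_neg] at h2; exact h2.le
  set χ : ℝ → ℝ := fun x => max 0 (min 1 (R + 1 - |x|)) with hχ
  have hχ0 : ∀ x, 0 ≤ χ x := fun x => le_max_left _ _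
  have hχ1 : ∀ x, χ x ≤ 1 := fun x => max_le zero_le_one (min_le_left _ _)
  obtain ⟨φ, hφ, happ⟩ := exists_mem_reluSpan_approx k hk (fun x => g x * χ x) (R + 1)
    (by fun_prop) (fun x hx => by
      have : χ x = 0 := max_eq_left ((min_le_right _ _).trans (by linarith))
      rw [this, mul_zero]) (ε / 4) (by positivity)
  have hcut : ∀ x, |g x - g x * χ x| ≤ ε / 4 * (1 + |x| ^ k) := fun x => by
    rcases le_total R |x| with hx | hx
    · refine le_trans ?_ (hgR x hx)
      rw [← mul_one_sub, abs_mul]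
      refine mul_le_of_le_one_right (abs_nonneg _) ?_
      rw [abs_le]
      constructor <;> linarith [hχ0 x, hχ1 x]
    · have : χ x = 1 := by
        simp only [hχ]
        rw [min_eq_left (by linarith), max_eq_right zero_le_one]
      rw [this, mul_one, sub_self, abs_zero]
      exact mul_nonneg (by positivity) (hw x).le
  have hmem : (Lp • fun x : ℝ => max (1 * x + 0) 0 ^ k)
      + (Lm • fun x : ℝ => max (-1 * x + 0) 0 ^ k) + φ ∈ reluSpan k :=
    Submodule.add_mem _ (Submodule.add_mem _
      (Submodule.smul_mem _ _ (relu_mem_reluSpan k one_ne_zero _))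
      (Submodule.smul_mem _ _ (relu_mem_reluSpan k (by norm_num) _))) hφ
  obtain ⟨N, c, ψ, hsum⟩ := Submodule.mem_span_set'.1 hmem
  choose a b ha hψ using fun j => (ψ j).2
  refine ⟨N, c, a, b, ha, lt_of_le_of_lt (ciSup_le (c := ε / 2) fun x => ?_) (by linarith)⟩
  have hx : ∑ j, c j * max (a j * x + b j) 0 ^ k
      = Lp * max x 0 ^ k + Lm * max (-x) 0 ^ k + φ x := by
    have := congrFun hsum x
    simpa [hψ, Finset.sum_apply] using this
  rw [hx, div_le_iff₀ (hw x)]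
  have hsplit : f x - (Lp * max x 0 ^ k + Lm * max (-x) 0 ^ k + φ x)
      = (g x - g x * χ x) + (g x * χ x - φ x) := by
    simp only [hg]; ring
  rw [hsplit]
  refine (abs_add_le _ _).trans ((add_le_add (hcut x) (happ x)).trans ?_)
  have : 0 ≤ |x| ^ k := by positivity
  nlinarith
end

section
/- Let k ≥ 1 be an integer and let σ : ℝ → ℝ be a continuous k-sigmoidal function. Then the linear span H_σ(ℝ) of the functions x ↦ σ(ax+b), with a ≠ 0 and b ∈ ℝ, is dense in the normed space 𝒴_k(ℝ): for every f ∈ 𝒴_k(ℝ) and every ε > 0 there exist c_1,…,c_N ∈ ℝ, a_1,…,a_N ∈ ℝ \ {0} and b_1,…,b_N ∈ ℝ such that sup_{x∈ℝ} |f(x) − Σ_{j=1}^N c_j σ(a_j x + b_j)| / (1+|x|^k) < ε. -/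
open Filter

/-- The truncated power `x ↦ (x - t)₊ ^ j`, with value `1` on `[t, ∞)` when `j = 0`. -/
noncomputable def truncPow (j : ℕ) (t x : ℝ) : ℝ := if t ≤ x then (x - t) ^ j else 0

theorem truncPow_succ_eq_max (j : ℕ) (t x : ℝ) :
    truncPow (j + 1) t x = max (x - t) 0 ^ (j + 1) := by
  unfold truncPow
  split_ifs with h
  · rw [max_eq_left (by linarith)]
  · rw [max_eq_right (by linarith)]; simp

theorem continuous_truncPow_succ (j : ℕ) (t : ℝ) : Continuous (truncPow (j + 1) t) := by
  rw [show truncPow (j + 1) t = fun x => max (x - t) 0 ^ (j + 1) from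
    funext (truncPow_succ_eq_max j t)]
  fun_prop

theorem monotone_truncPow (j : ℕ) (t : ℝ) : Monotone (truncPow j t) := by
  intro x y hxy
  unfold truncPow
  split_ifs with h₁ h₂
  · have : 0 ≤ x - t := by linarith
    gcongr
  · linarith
  · have : 0 ≤ y - t := by linarith
    positivity
  · exact le_rfl

theorem hasDerivAt_truncPow_succ (j : ℕ) {t x : ℝ} (hx : x ≠ t) :
    HasDerivAt (truncPow (j + 1) t) ((j + 1) * truncPow j t x) x := by
  rcases lt_or_gt_of_ne hx with h | h
  · have hev : truncPow (j + 1) t =ᶠ[nhds x] fun _ => 0 := by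
      filter_upwards [Iio_mem_nhds h] with y hy
      simp [truncPow, not_le.mpr (Set.mem_Iio.mp hy)]
    simpa [truncPow, not_le.mpr h] using (hasDerivAt_const x (0 : ℝ)).congr_of_eventuallyEq hev
  · have hev : truncPow (j + 1) t =ᶠ[nhds x] fun y => (y - t) ^ (j + 1) := by
      filter_upwards [Ioi_mem_nhds h] with y hy
      simp [truncPow, (Set.mem_Ioi.mp hy).le]
    have := (((hasDerivAt_id x).sub_const t).pow (j + 1)).congr_of_eventuallyEq hev
    simpa [truncPow, h.le] using this

theorem integral_truncPow (j : ℕ) (t a b : ℝ) :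
    ∫ s in a..b, truncPow j t s =
      ((j : ℝ) + 1)⁻¹ * (truncPow (j + 1) t b - truncPow (j + 1) t a) := by
  have h := MeasureTheory.integral_eq_of_hasDerivAt_off_countable
    (truncPow (j + 1) t) (fun s => ((j : ℝ) + 1) * truncPow j t s)
    (a := a) (b := b) (Set.countable_singleton t)
    (continuous_truncPow_succ j t).continuousOn
    (fun x hx => hasDerivAt_truncPow_succ j hx.2)
    ((monotone_truncPow j t).intervalIntegrable.const_mul _)
  rw [intervalIntegral.integral_const_mul] at h
  rw [← h]
  have : (j : ℝ) + 1 ≠ 0 := by positivity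
  field_simp

/-- The span of the truncated powers of degree `j`. -/
noncomputable def truncPowSpan (j : ℕ) : Submodule ℝ (ℝ → ℝ) :=
  Submodule.span ℝ (Set.range (truncPow j))

theorem truncPow_mem_truncPowSpan (j : ℕ) (t : ℝ) : truncPow j t ∈ truncPowSpan j :=
  Submodule.subset_span ⟨t, rfl⟩

theorem intervalIntegrable_of_mem_truncPowSpan {j : ℕ} {g : ℝ → ℝ} (hg : g ∈ truncPowSpan j)
    (a b : ℝ) : IntervalIntegrable g MeasureTheory.volume a b := by
  induction hg using Submodule.span_induction with
  | mem g hg =>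
    obtain ⟨t, rfl⟩ := hg
    exact (monotone_truncPow j t).intervalIntegrable
  | zero => exact intervalIntegrable_const
  | add g h _ _ hg hh => exact hg.add hh
  | smul c g _ hg => exact hg.const_mul c

theorem integral_mem_truncPowSpan {j : ℕ} {g : ℝ → ℝ} (hg : g ∈ truncPowSpan j) (δ : ℝ) :
    (fun x => ∫ s in x..(x + δ), g s) ∈ truncPowSpan (j + 1) := by
  induction hg using Submodule.span_induction with
  | mem g hg =>
    obtain ⟨t, rfl⟩ := hg
    have : (fun x => ∫ s in x..(x + δ), truncPow j t s) =
        ((j : ℝ) + 1)⁻¹ • (truncPow (j + 1) (t - δ) - truncPow (j + 1) t) := by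
      funext x
      rw [integral_truncPow]
      simp only [truncPow_succ_eq_max, Pi.smul_apply, Pi.sub_apply, smul_eq_mul]
      rw [show x - (t - δ) = x + δ - t by ring]
    rw [this]
    exact Submodule.smul_mem _ _ (Submodule.sub_mem _ (truncPow_mem_truncPowSpan _ _)
      (truncPow_mem_truncPowSpan _ _))
  | zero =>
    convert Submodule.zero_mem (truncPowSpan (j + 1)) using 1
    funext x
    simp
  | add g h hg hh ihg ihh =>
    convert Submodule.add_mem _ ihg ihh using 1
    funext x
    exact intervalIntegral.integral_add (intervalIntegrable_of_mem_truncPowSpan hg _ _)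
      (intervalIntegrable_of_mem_truncPowSpan hh _ _)
  | smul c g hg ih =>
    convert Submodule.smul_mem _ c ih using 1
    funext x
    exact intervalIntegral.integral_const_mul c g

theorem exists_step_approx {f : ℝ → ℝ} (hf : UniformContinuous f) {R : ℝ}
    (hR : ∀ x, R ≤ |x| → f x = 0) {ε : ℝ} (hε : 0 < ε) :
    ∃ g ∈ truncPowSpan 0, ∀ x, |f x - g x| ≤ ε := by
  obtain ⟨δ, hδ, hfδ⟩ := Metric.uniformContinuous_iff.mp hf ε hε
  set η := δ / 2 with hη
  have hη0 : 0 < η := by positivity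
  set S := max R 0
  have hRS : R ≤ S := le_max_left _ _
  have hS0 : 0 ≤ S := le_max_right _ _
  obtain ⟨n, hn⟩ := exists_nat_ge (2 * S / η)
  rw [div_le_iff₀ hη0] at hn
  let u : ℕ → ℝ := fun i => -S + i * η
  refine ⟨∑ i ∈ Finset.range n, (f (u (i + 1)) - f (u i)) • truncPow 0 (u i),
    Submodule.sum_mem _ fun i _ => Submodule.smul_mem _ _ (truncPow_mem_truncPowSpan _ _),
    fun x => ?_⟩
  have hu0 : f (u 0) = 0 := hR _ (by simp [u, abs_of_nonneg hS0, hRS])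
  have hzero : ∀ y, S ≤ y → f y = 0 := fun y hy =>
    hR y (by rw [abs_of_nonneg (hS0.trans hy)]; linarith)
  simp only [Finset.sum_apply, Pi.smul_apply, smul_eq_mul, truncPow, pow_zero, mul_ite, mul_one,
    mul_zero]
  rw [← Finset.sum_filter]
  by_cases hx : x < -S
  · rw [Finset.filter_false_of_mem, Finset.sum_empty, hR x, sub_zero, abs_zero]
    · exact hε.le
    · rw [abs_of_neg (by linarith)]; linarith
    · intro i _
      have : (0 : ℝ) ≤ i * η := by positivity
      simp only [u]; linarith
  · push Not at hx
    set m := ⌊(x + S) / η⌋₊ with hm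
    have hq : 0 ≤ (x + S) / η := div_nonneg (by linarith) hη0.le
    have hm1 : m * η ≤ x + S := by
      rw [← le_div_iff₀ hη0]; exact Nat.floor_le hq
    have hm2 : x + S < (m + 1) * η := by
      rw [← div_lt_iff₀ hη0]; exact Nat.lt_floor_add_one _
    have hfilter : (Finset.range n).filter (fun i => u i ≤ x) = Finset.range (min n (m + 1)) := by
      ext i
      simp only [Finset.mem_filter, Finset.mem_range, lt_min_iff, Nat.lt_succ_iff, hm,
        Nat.le_floor_iff hq, le_div_iff₀ hη0, u]
      constructor <;> rintro ⟨h₁, h₂⟩ <;> exact ⟨h₁, by linarith⟩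
    rw [hfilter, Finset.sum_range_sub (fun i => f (u i)), hu0, sub_zero]
    rcases le_total n (m + 1) with h | h
    · rw [min_eq_left h, hzero (u n) (by simp only [u]; linarith)]
      rcases h.lt_or_eq with h' | h'
      · have : (n : ℝ) * η ≤ m * η := by gcongr; omega
        rw [hzero x (by linarith), sub_zero, abs_zero]
        exact hε.le
      · have hd : dist (f x) (f (u n)) < ε := by
          apply hfδ
          rw [Real.dist_eq, abs_lt]
          simp only [u, h']
          push_cast
          constructor <;> linarith
        rw [Real.dist_eq, hzero (u n) (by simp only [u]; linarith)] at hd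
        exact hd.le
    · rw [min_eq_right h, ← Real.dist_eq]
      refine (hfδ ?_).le
      rw [Real.dist_eq, abs_lt]
      simp only [u]
      push_cast
      constructor <;> linarith

theorem exists_truncPowSpan_approx (j : ℕ) {f : ℝ → ℝ} (hf : UniformContinuous f) {R : ℝ}
    (hR : ∀ x, R ≤ |x| → f x = 0) {ε : ℝ} (hε : 0 < ε) :
    ∃ g ∈ truncPowSpan j, ∀ x, |f x - g x| ≤ ε := by
  induction j generalizing ε with
  | zero => exact exists_step_approx hf hR hε
  | succ j ih =>
    obtain ⟨g, hg, hfg⟩ := ih (half_pos hε)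
    obtain ⟨δ, hδ, hfδ⟩ := Metric.uniformContinuous_iff.mp hf (ε / 2) (half_pos hε)
    set η := δ / 2 with hη
    have hη0 : 0 < η := by positivity
    refine ⟨η⁻¹ • fun x => ∫ s in x..(x + η), g s,
      Submodule.smul_mem _ _ (integral_mem_truncPowSpan hg η), fun x => ?_⟩
    have hbound : ‖∫ s in x..(x + η), (f x - g s)‖ ≤ ε * |x + η - x| := by
      apply intervalIntegral.norm_integral_le_of_norm_le_const
      intro s hs
      rw [Set.uIoc_of_le (by linarith)] at hs
      have h₁ : dist (f x) (f s) < ε / 2 := by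
        apply hfδ
        rw [Real.dist_eq, abs_lt]
        constructor <;> linarith [hs.1, hs.2]
      rw [Real.dist_eq] at h₁
      calc ‖f x - g s‖ = |(f x - f s) + (f s - g s)| := by rw [Real.norm_eq_abs]; congr 1; ring
        _ ≤ |f x - f s| + |f s - g s| := abs_add_le _ _
        _ ≤ ε := by linarith [hfg s]
    rw [intervalIntegral.integral_sub intervalIntegrable_const
      (intervalIntegrable_of_mem_truncPowSpan hg _ _), intervalIntegral.integral_const,
      add_sub_cancel_left, abs_of_pos hη0, Real.norm_eq_abs, smul_eq_mul] at hbound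
    simp only [Pi.smul_apply, smul_eq_mul]
    rw [show f x - η⁻¹ * ∫ s in x..(x + η), g s =
      η⁻¹ * (η * f x - ∫ s in x..(x + η), g s) by field_simp, abs_mul,
      abs_of_pos (inv_pos.mpr hη0), inv_mul_le_iff₀ hη0]
    linarith

/-- The closure of `V` for uniform approximation with respect to the weight `1 + |x| ^ k`. -/
def weightedClosure (k : ℕ) (V : Submodule ℝ (ℝ → ℝ)) : Submodule ℝ (ℝ → ℝ) where
  carrier := {f | ∀ ε > 0, ∃ g ∈ V, ∀ x, |f x - g x| ≤ ε * (1 + |x| ^ k)}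
  zero_mem' ε hε := ⟨0, V.zero_mem, fun x => by
    simp only [Pi.zero_apply, sub_zero, abs_zero]; positivity⟩
  add_mem' := by
    intro f₁ f₂ h₁ h₂ ε hε
    obtain ⟨g₁, hg₁, hfg₁⟩ := h₁ (ε / 2) (half_pos hε)
    obtain ⟨g₂, hg₂, hfg₂⟩ := h₂ (ε / 2) (half_pos hε)
    refine ⟨g₁ + g₂, V.add_mem hg₁ hg₂, fun x => ?_⟩
    calc |(f₁ + f₂) x - (g₁ + g₂) x| = |(f₁ x - g₁ x) + (f₂ x - g₂ x)| := by
          simp only [Pi.add_apply]; congr 1; ring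
      _ ≤ |f₁ x - g₁ x| + |f₂ x - g₂ x| := abs_add_le _ _
      _ ≤ ε * (1 + |x| ^ k) := by linarith [hfg₁ x, hfg₂ x]
  smul_mem' := by
    intro c f h ε hε
    obtain ⟨g, hg, hfg⟩ := h (ε / (|c| + 1)) (by positivity)
    refine ⟨c • g, V.smul_mem c hg, fun x => ?_⟩
    simp only [Pi.smul_apply, smul_eq_mul]
    rw [← mul_sub, abs_mul]
    calc |c| * |f x - g x| ≤ (|c| + 1) * (ε / (|c| + 1) * (1 + |x| ^ k)) := by
          gcongr
          · linarith
          · exact hfg x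
      _ = ε * (1 + |x| ^ k) := by field_simp

theorem mem_weightedClosure_of_forall_exists {k : ℕ} {V : Submodule ℝ (ℝ → ℝ)} {f : ℝ → ℝ}
    (h : ∀ ε > 0, ∃ g ∈ weightedClosure k V, ∀ x, |f x - g x| ≤ ε * (1 + |x| ^ k)) :
    f ∈ weightedClosure k V := by
  intro ε hε
  obtain ⟨g, hg, hfg⟩ := h (ε / 2) (half_pos hε)
  obtain ⟨g', hg', hgg'⟩ := hg (ε / 2) (half_pos hε)
  refine ⟨g', hg', fun x => ?_⟩
  linarith [abs_sub_le (f x) (g x) (g' x), hfg x, hgg' x]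

/-- The span of the functions `x ↦ σ (a x + b)` with `a ≠ 0`. -/
def sigmoidalSpan (σ : ℝ → ℝ) : Submodule ℝ (ℝ → ℝ) :=
  Submodule.span ℝ {g | ∃ a b : ℝ, a ≠ 0 ∧ g = fun x => σ (a * x + b)}

theorem exists_abs_sub_truncPow_le {k : ℕ} {σ : ℝ → ℝ} (hσ_cont : Continuous σ)
    (hσ_bot : Tendsto (fun x : ℝ => σ x / x ^ k) atBot (nhds 0))
    (hσ_top : Tendsto (fun x : ℝ => σ x / x ^ k) atTop (nhds 1)) {ε : ℝ} (hε : 0 < ε) :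
    ∃ C, 0 ≤ C ∧ ∀ y, |σ y - truncPow k 0 y| ≤ ε * |y| ^ k + C := by
  obtain ⟨A, hA⟩ := eventually_atBot.mp (Metric.tendsto_nhds.mp hσ_bot ε hε)
  obtain ⟨B, hB⟩ := eventually_atTop.mp (Metric.tendsto_nhds.mp hσ_top ε hε)
  set S := max (max (-A) B) 1
  have hSA : -A ≤ S := (le_max_left _ _).trans (le_max_left _ _)
  have hSB : B ≤ S := (le_max_right _ _).trans (le_max_left _ _)
  have hS1 : 1 ≤ S := le_max_right _ _
  obtain ⟨D, hD⟩ := (isCompact_Icc (a := -S) (b := S)).exists_bound_of_continuousOn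
    hσ_cont.continuousOn
  have hD0 : 0 ≤ D := (norm_nonneg _).trans (hD 0 ⟨by linarith, by linarith⟩)
  refine ⟨D + S ^ k, by positivity, fun y => ?_⟩
  have hC : 0 ≤ D + S ^ k := by positivity
  have hpos : 0 ≤ ε * |y| ^ k := by positivity
  rcases lt_or_ge y (-S) with h₁ | h₁
  · have h := hA y (by linarith)
    have hy : 0 < |y| ^ k := pow_pos (abs_pos.mpr (by linarith)) k
    rw [Real.dist_eq, sub_zero, abs_div, abs_pow, div_lt_iff₀ hy] at h
    rw [truncPow, if_neg (by linarith), sub_zero]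
    linarith
  rcases le_or_gt y S with h₂ | h₂
  · have hσy := hD y ⟨h₁, h₂⟩
    rw [Real.norm_eq_abs] at hσy
    have ht : |truncPow k 0 y| ≤ S ^ k := by
      unfold truncPow
      split_ifs with h
      · rw [sub_zero, abs_pow, abs_of_nonneg h]
        gcongr
      · rw [abs_zero]; positivity
    linarith [abs_sub (σ y) (truncPow k 0 y)]
  · have h := hB y (by linarith)
    have hy0 : 0 < y := by linarith
    have hy : 0 < y ^ k := pow_pos hy0 k
    rw [Real.dist_eq, div_sub_one hy.ne', abs_div, abs_of_pos hy, div_lt_iff₀ hy] at h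
    rw [truncPow, if_pos hy0.le, sub_zero, abs_of_pos hy0]
    linarith

theorem truncPow_zero_mul (k : ℕ) {r : ℝ} (hr : 0 < r) (y : ℝ) :
    truncPow k 0 (r * y) = r ^ k * truncPow k 0 y := by
  simp only [truncPow, sub_zero, mul_nonneg_iff_of_pos_left hr, mul_pow, mul_ite, mul_zero]

theorem abs_affine_pow_le (k : ℕ) (a b x : ℝ) :
    |a * x + b| ^ k ≤ (|a| + |b|) ^ k * 2 ^ (k - 1) * (1 + |x| ^ k) := by
  have h₁ : |a * x + b| ≤ (|a| + |b|) * (1 + |x|) := by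
    have := abs_add_le (a * x) b
    rw [abs_mul] at this
    nlinarith [abs_nonneg a, abs_nonneg b, abs_nonneg x, mul_nonneg (abs_nonneg b) (abs_nonneg x)]
  calc |a * x + b| ^ k ≤ ((|a| + |b|) * (1 + |x|)) ^ k := by gcongr
    _ = (|a| + |b|) ^ k * (1 + |x|) ^ k := mul_pow _ _ _
    _ ≤ (|a| + |b|) ^ k * (2 ^ (k - 1) * (1 ^ k + |x| ^ k)) := by
        gcongr
        exact add_pow_le zero_le_one (abs_nonneg x) k
    _ = _ := by rw [one_pow]; ring

theorem truncPow_affine_mem_weightedClosure {k : ℕ} (hk : 1 ≤ k) {σ : ℝ → ℝ}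
    (hσ_cont : Continuous σ)
    (hσ_bot : Tendsto (fun x : ℝ => σ x / x ^ k) atBot (nhds 0))
    (hσ_top : Tendsto (fun x : ℝ => σ x / x ^ k) atTop (nhds 1)) {a : ℝ} (ha : a ≠ 0) (b : ℝ) :
    (fun x => truncPow k 0 (a * x + b)) ∈ weightedClosure k (sigmoidalSpan σ) := by
  intro ε hε
  set M := (|a| + |b|) ^ k * 2 ^ (k - 1)
  have hM0 : 0 ≤ M := by positivity
  obtain ⟨C, hC0, hC⟩ := exists_abs_sub_truncPow_le hσ_cont hσ_bot hσ_top
    (ε := ε / (2 * (M + 1))) (by positivity)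
  set r := 2 * C / ε + 1 with hr
  have hr1 : 1 ≤ r := by
    have : 0 ≤ 2 * C / ε := by positivity
    linarith
  have hr0 : 0 < r := by linarith
  have hrk : 0 < r ^ k := pow_pos hr0 k
  have hCr : C ≤ ε / 2 * r ^ k := by
    have h₁ : r ≤ r ^ k := le_self_pow₀ hr1 (by omega)
    have h₂ : C ≤ ε / 2 * r := by rw [hr]; field_simp; linarith
    exact h₂.trans (by gcongr)
  refine ⟨(r ^ k)⁻¹ • fun x => σ (r * a * x + r * b), Submodule.smul_mem _ _
    (Submodule.subset_span ⟨r * a, r * b, mul_ne_zero hr0.ne' ha, rfl⟩), fun x => ?_⟩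
  have h := hC (r * (a * x + b))
  rw [truncPow_zero_mul k hr0, abs_mul, abs_of_pos hr0, mul_pow] at h
  simp only [Pi.smul_apply, smul_eq_mul]
  rw [show truncPow k 0 (a * x + b) - (r ^ k)⁻¹ * σ (r * a * x + r * b) =
      -((r ^ k)⁻¹ * (σ (r * (a * x + b)) - r ^ k * truncPow k 0 (a * x + b))) by
    rw [show r * (a * x + b) = r * a * x + r * b by ring]
    field_simp
    ring, abs_neg, abs_mul, abs_of_pos (inv_pos.mpr hrk), inv_mul_le_iff₀ hrk]
  have hx : 1 ≤ 1 + |x| ^ k := le_add_of_nonneg_right (by positivity)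
  calc |σ (r * (a * x + b)) - r ^ k * truncPow k 0 (a * x + b)|
      ≤ ε / (2 * (M + 1)) * (r ^ k * |a * x + b| ^ k) + C := h
    _ ≤ ε / (2 * (M + 1)) * (r ^ k * ((M + 1) * (1 + |x| ^ k)))
          + ε / 2 * r ^ k * (1 + |x| ^ k) := by
        gcongr
        · refine (abs_affine_pow_le k a b x).trans ?_
          gcongr
          linarith
        · exact hCr.trans (le_mul_of_one_le_right (by positivity) hx)
    _ = r ^ k * (ε * (1 + |x| ^ k)) := by field_simp; ring

theorem tendsto_pow_div_one_add_pow {k : ℕ} (hk : 1 ≤ k) :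
    Tendsto (fun x : ℝ => x ^ k / (1 + x ^ k)) atTop (nhds 1) := by
  have h : Tendsto (fun x : ℝ => 1 - (1 + x ^ k)⁻¹) atTop (nhds (1 - 0)) :=
    tendsto_const_nhds.sub (tendsto_inv_atTop_zero.comp
      (tendsto_atTop_add_const_left _ 1 (tendsto_pow_atTop (by omega))))
  rw [sub_zero] at h
  refine h.congr' ?_
  filter_upwards [eventually_ge_atTop 0] with x hx
  have : 0 < 1 + x ^ k := by positivity
  field_simp
  ring

/-- A compactly supported continuous cutoff of `r` at radius `R`. -/
theorem exists_cutoff {r : ℝ → ℝ} (hr : Continuous r) (R : ℝ) :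
    ∃ g : ℝ → ℝ, UniformContinuous g ∧ (∀ x, R + 1 ≤ |x| → g x = 0) ∧
      (∀ x, |x| ≤ R → g x = r x) ∧ ∀ x, |r x - g x| ≤ |r x| := by
  let χ : ℝ → ℝ := fun x => max 0 (min 1 (R + 1 - |x|))
  have hχ0 : ∀ x, 0 ≤ χ x := fun x => le_max_left _ _
  have hχ1 : ∀ x, χ x ≤ 1 := fun x => max_le zero_le_one (min_le_left _ _)
  have hzero : ∀ x, R + 1 ≤ |x| → r x * χ x = 0 := fun x hx => by
    simp only [χ]
    rw [max_eq_left ((min_le_right _ _).trans (by linarith)), mul_zero]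
  have hcont : Continuous fun x => r x * χ x := by fun_prop
  refine ⟨fun x => r x * χ x, ?_, hzero, fun x hx => ?_, fun x => ?_⟩
  · refine hcont.uniformContinuous_of_tendsto_cocompact (x := 0) ?_
    refine tendsto_const_nhds.congr' ?_
    filter_upwards [tendsto_norm_cocompact_atTop.eventually_ge_atTop (R + 1)] with x hx
    exact (hzero x hx).symm
  · simp only [χ]
    rw [min_eq_left (by linarith), max_eq_right zero_le_one, mul_one]
  · simp only
    rw [← mul_one_sub, abs_mul]
    refine mul_le_of_le_one_right (abs_nonneg _) ?_
    rw [abs_le]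
    constructor <;> linarith [hχ0 x, hχ1 x]

theorem mem_weightedClosure_of_tendsto_zero {k : ℕ} {V : Submodule ℝ (ℝ → ℝ)}
    (hV : truncPowSpan k ≤ weightedClosure k V) {r : ℝ → ℝ} (hr : Continuous r)
    (hr_top : Tendsto (fun x : ℝ => r x / (1 + |x| ^ k)) atTop (nhds 0))
    (hr_bot : Tendsto (fun x : ℝ => r x / (1 + |x| ^ k)) atBot (nhds 0)) :
    r ∈ weightedClosure k V := by
  refine mem_weightedClosure_of_forall_exists fun ε hε => ?_
  obtain ⟨B, hB⟩ := eventually_atTop.mp (Metric.tendsto_nhds.mp hr_top _ (half_pos hε))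
  obtain ⟨A, hA⟩ := eventually_atBot.mp (Metric.tendsto_nhds.mp hr_bot _ (half_pos hε))
  obtain ⟨g, hg_unif, hg_zero, hg_eq, hg_le⟩ := exists_cutoff hr (max (-A) B)
  obtain ⟨p, hp, hgp⟩ := exists_truncPowSpan_approx k hg_unif hg_zero (half_pos hε)
  refine ⟨p, hV hp, fun x => ?_⟩
  have hw : 0 < 1 + |x| ^ k := by positivity
  have hx : 1 ≤ 1 + |x| ^ k := le_add_of_nonneg_right (by positivity)
  have hrg : |r x - g x| ≤ ε / 2 * (1 + |x| ^ k) := by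
    rcases le_or_gt |x| (max (-A) B) with h | h
    · rw [hg_eq x h, sub_self, abs_zero]
      positivity
    · refine (hg_le x).trans ?_
      have hd : dist (r x / (1 + |x| ^ k)) 0 < ε / 2 := by
        rcases lt_abs.mp h with h | h
        · exact hB x ((le_max_right _ _).trans h.le)
        · exact hA x (by linarith [le_max_left (-A) B])
      rw [Real.dist_eq, sub_zero, abs_div, abs_of_pos hw, div_lt_iff₀ hw] at hd
      exact hd.le
  have hgp' : |g x - p x| ≤ ε / 2 * (1 + |x| ^ k) :=
    (hgp x).trans (le_mul_of_one_le_right (by positivity) hx)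
  linarith [abs_sub_le (r x) (g x) (p x)]

/-- Global universality for continuous `k`-sigmoidal activation functions:
the span of `x ↦ σ(a x + b)` (`a ≠ 0`) is dense in `𝒴_k(ℝ)`. -/
theorem sigmoidal_span_dense_in_Yk (k : ℕ) (hk : 1 ≤ k) (σ : ℝ → ℝ)
    (hσ_cont : Continuous σ)
    (hσ_bot : Tendsto (fun x : ℝ => σ x / x ^ k) atBot (nhds 0))
    (hσ_top : Tendsto (fun x : ℝ => σ x / x ^ k) atTop (nhds 1))
    (f : ℝ → ℝ) (hf_cont : Continuous f)
    (hf_top : ∃ L : ℝ, Tendsto (fun x : ℝ => f x / (1 + |x| ^ k)) atTop (nhds L))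
    (hf_bot : ∃ L : ℝ, Tendsto (fun x : ℝ => f x / (1 + |x| ^ k)) atBot (nhds L))
    (ε : ℝ) (hε : 0 < ε) :
    ∃ (N : ℕ) (c a b : Fin N → ℝ), (∀ j, a j ≠ 0) ∧
      (⨆ x : ℝ, |f x - ∑ j, c j * σ (a j * x + b j)| / (1 + |x| ^ k)) < ε := by
  set V := weightedClosure k (sigmoidalSpan σ)
  have hmem : ∀ {a : ℝ}, a ≠ 0 → ∀ b, (fun x => truncPow k 0 (a * x + b)) ∈ V :=
    fun ha b => truncPow_affine_mem_weightedClosure hk hσ_cont hσ_bot hσ_top ha b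
  have hspan : truncPowSpan k ≤ V := by
    refine Submodule.span_le.mpr ?_
    rintro _ ⟨t, rfl⟩
    have h := hmem one_ne_zero (-t)
    rwa [show (fun x => truncPow k 0 (1 * x + -t)) = truncPow k t by
      funext x
      simp [truncPow, ← sub_eq_add_neg]] at h
  obtain ⟨L, hL⟩ := hf_top
  obtain ⟨L', hL'⟩ := hf_bot
  set p : ℝ → ℝ := (L • fun x => truncPow k 0 (1 * x + 0)) +
    L' • fun x => truncPow k 0 (-1 * x + 0) with hp
  have hpV : p ∈ V := V.add_mem (V.smul_mem _ (hmem one_ne_zero 0))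
    (V.smul_mem _ (hmem (neg_ne_zero.mpr one_ne_zero) 0))
  have hp_cont : Continuous p := by
    obtain ⟨j, rfl⟩ := Nat.exists_eq_add_of_le' hk
    have := continuous_truncPow_succ j 0
    fun_prop
  have hp_top : Tendsto (fun x : ℝ => p x / (1 + |x| ^ k)) atTop (nhds L) := by
    have h := (tendsto_pow_div_one_add_pow hk).const_mul L
    rw [mul_one] at h
    refine h.congr' ?_
    filter_upwards [eventually_gt_atTop 0] with x hx
    simp [hp, truncPow, hx.le, not_le.mpr hx, abs_of_pos hx, mul_div_assoc]
  have hp_bot : Tendsto (fun x : ℝ => p x / (1 + |x| ^ k)) atBot (nhds L') := by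
    have h := ((tendsto_pow_div_one_add_pow hk).comp tendsto_neg_atBot_atTop).const_mul L'
    rw [mul_one] at h
    refine h.congr' ?_
    filter_upwards [eventually_lt_atBot 0] with x hx
    simp [hp, truncPow, hx.le, not_le.mpr hx, abs_of_neg hx, mul_div_assoc]
  have hr : f - p ∈ V := by
    refine mem_weightedClosure_of_tendsto_zero hspan (hf_cont.sub hp_cont) ?_ ?_
    · simpa [sub_div] using hL.sub hp_top
    · simpa [sub_div] using hL'.sub hp_bot
  have hfV : f ∈ V := by simpa using V.add_mem hr hpV
  obtain ⟨g, hg, hfg⟩ := hfV (ε / 2) (half_pos hε)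
  obtain ⟨N, c, s, rfl⟩ := Submodule.mem_span_set'.mp hg
  choose a b ha hs using fun j => (s j).2
  refine ⟨N, c, a, b, ha, (ciSup_le fun x => ?_).trans_lt (half_lt_self hε)⟩
  rw [div_le_iff₀ (by positivity)]
  simpa [hs] using hfg x
end

section
/- Let k ≥ 1 be an integer, let f : ℝ → ℝ be continuous with compact support contained in the interval [−a′, a], where a, a′ > 0, and let ε > 0. Then there exists a finite linear combination τ of functions x ↦ ReLU^k(αx + β) (with real coefficients, α ≠ 0, β ∈ ℝ) such that τ has support contained in [−a′, a] and sup_{x∈ℝ} |f(x) − τ(x)| ≤ ε. In particular, every compactly supported continuous function on ℝ can be approximated uniformly on ℝ by compactly supported elements of H_{ReLU^k}(ℝ). -/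
open Finset fwdDiff

/-- The (uncentred) cardinal B-spline of degree `k`, as a forward difference of `ReLU ^ k`. -/
noncomputable def cardinalBSpline (k : ℕ) (y : ℝ) : ℝ :=
  (k.factorial : ℝ)⁻¹ * (Δ_[(1 : ℝ)])^[k + 1] (fun t : ℝ => max t 0 ^ k) y

lemma fwdDiff_iter_relu_pow_of_nonpos {k n : ℕ} (hk : k ≠ 0) {y : ℝ} (hy : y ≤ -n) :
    (Δ_[(1 : ℝ)])^[n] (fun t : ℝ => max t 0 ^ k) y = 0 := by
  rw [fwdDiff_iter_eq_sum_shift]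
  refine sum_eq_zero fun i hi => ?_
  have hi' : (i : ℝ) ≤ n := by exact_mod_cast Nat.lt_succ_iff.1 (mem_range.1 hi)
  have h : max (y + i • (1 : ℝ)) 0 = 0 := max_eq_right (by simp; linarith)
  simp only [h, zero_pow hk, smul_zero]

lemma fwdDiff_iter_relu_pow_of_nonneg {k n : ℕ} {y : ℝ} (hy : 0 ≤ y) :
    (Δ_[(1 : ℝ)])^[n] (fun t : ℝ => max t 0 ^ k) y =
      (Δ_[(1 : ℝ)])^[n] (fun t : ℝ => t ^ k) y := by
  rw [fwdDiff_iter_eq_sum_shift, fwdDiff_iter_eq_sum_shift]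
  refine sum_congr rfl fun i _ => ?_
  have h : max (y + i • (1 : ℝ)) 0 = y + i • (1 : ℝ) := max_eq_left (by simp; positivity)
  simp only [h]

lemma cardinalBSpline_eq_sum (k : ℕ) (y : ℝ) :
    cardinalBSpline k y = ∑ i ∈ range (k + 2),
      ((k.factorial : ℝ)⁻¹ * ((-1) ^ (k + 1 - i) * (k + 1).choose i)) * max (y + i) 0 ^ k := by
  rw [cardinalBSpline, fwdDiff_iter_eq_sum_shift, mul_sum]
  refine sum_congr rfl fun i _ => ?_
  simp [mul_assoc]

lemma continuous_cardinalBSpline (k : ℕ) : Continuous (cardinalBSpline k) := by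
  simp only [funext (cardinalBSpline_eq_sum k)]
  fun_prop

lemma cardinalBSpline_eq_zero {k : ℕ} (hk : k ≠ 0) {y : ℝ}
    (hy : y ∉ Set.Icc (-(k + 1) : ℝ) 0) : cardinalBSpline k y = 0 := by
  rw [cardinalBSpline]
  rcases le_total y (-(k + 1)) with h | h
  · rw [fwdDiff_iter_relu_pow_of_nonpos hk (by push_cast; exact h), mul_zero]
  · have h0 : 0 ≤ y := not_lt.1 fun h0 => hy ⟨h, h0.le⟩
    rw [fwdDiff_iter_relu_pow_of_nonneg h0, fwdDiff_iter_pow_eq_zero_of_lt (Nat.lt_succ_self k)]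
    simp

lemma exists_abs_cardinalBSpline_le {k : ℕ} (hk : k ≠ 0) :
    ∃ C : ℝ, 0 < C ∧ ∀ y, |cardinalBSpline k y| ≤ C := by
  obtain ⟨C, hC⟩ := (isCompact_Icc (a := (-(k + 1) : ℝ)) (b := 0)).exists_bound_of_continuousOn
    (continuous_cardinalBSpline k).continuousOn
  refine ⟨max C 1, by positivity, fun y => ?_⟩
  by_cases hy : y ∈ Set.Icc (-(k + 1) : ℝ) 0
  · exact (hC y hy).trans (le_max_left _ _)
  · rw [cardinalBSpline_eq_zero hk hy, abs_zero]
    positivity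

/-- Integer translates of the cardinal B-spline form a partition of unity. -/
lemma sum_range_cardinalBSpline_eq_one {k N : ℕ} (hk : k ≠ 0) {y : ℝ} (hy : y ≤ -k)
    (hN : 0 ≤ y + N) : ∑ j ∈ range N, cardinalBSpline k (y + j) = 1 := by
  have h (j : ℕ) : cardinalBSpline k (y + j) = (k.factorial : ℝ)⁻¹ *
      ((Δ_[(1 : ℝ)])^[k] (fun t : ℝ => max t 0 ^ k) (y + (j + 1 : ℕ)) -
        (Δ_[(1 : ℝ)])^[k] (fun t : ℝ => max t 0 ^ k) (y + j)) := by
    rw [cardinalBSpline, Function.iterate_succ_apply', fwdDiff]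
    push_cast
    rw [add_assoc]
  simp only [h]
  rw [← mul_sum, sum_range_sub (fun j : ℕ =>
    (Δ_[(1 : ℝ)])^[k] (fun t : ℝ => max t 0 ^ k) (y + j)), fwdDiff_iter_relu_pow_of_nonneg hN,
    fwdDiff_iter_relu_pow_of_nonpos hk (by simpa using hy), fwdDiff_iter_eq_factorial]
  simp [Nat.factorial_ne_zero]

lemma sum_range_abs_cardinalBSpline_le {k : ℕ} (hk : k ≠ 0) {C : ℝ}
    (hC : ∀ y, |cardinalBSpline k y| ≤ C) (N : ℕ) (y : ℝ) :
    ∑ j ∈ range N, |cardinalBSpline k (y + j)| ≤ (k + 2) * C := by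
  set m := ⌈-y - (k + 1)⌉₊
  have hsub : (range N).filter (fun j : ℕ => |cardinalBSpline k (y + j)| ≠ 0) ⊆ Icc m (m + (k + 1)) := by
    intro j hj
    have hmem : y + j ∈ Set.Icc (-(k + 1) : ℝ) 0 := by
      by_contra hmem
      exact (mem_filter.1 hj).2 (by rw [cardinalBSpline_eq_zero hk hmem, abs_zero])
    refine mem_Icc.2 ⟨Nat.ceil_le.2 (by linarith [hmem.1]), ?_⟩
    have hm : -y - (k + 1) ≤ m := Nat.le_ceil _
    have : (j : ℝ) ≤ m + (k + 1) := by linarith [hmem.2]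
    exact_mod_cast this
  calc ∑ j ∈ range N, |cardinalBSpline k (y + j)|
      = ∑ j ∈ (range N).filter (fun j : ℕ => |cardinalBSpline k (y + j)| ≠ 0),
          |cardinalBSpline k (y + j)| :=
        (sum_filter_ne_zero _).symm
    _ ≤ ∑ j ∈ Icc m (m + (k + 1)), |cardinalBSpline k (y + j)| :=
        sum_le_sum_of_subset_of_nonneg hsub fun _ _ _ => abs_nonneg _
    _ ≤ ∑ _j ∈ Icc m (m + (k + 1)), C := sum_le_sum fun _ _ => hC _
    _ = (k + 2) * C := by
        rw [sum_const, Nat.card_Icc, nsmul_eq_mul, show m + (k + 1) + 1 - m = k + 2 by lia]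
        push_cast
        rfl

/-- A finite combination of translates of a rescaled cardinal B-spline is a finite combination of
`ReLU ^ k` ridge functions. -/
lemma exists_sum_relu_pow_eq_sum_cardinalBSpline (k N : ℕ) (d : ℕ → ℝ) {s : ℝ} (hs : s ≠ 0)
    (b : ℝ) :
    ∃ (M : ℕ) (c α β : Fin M → ℝ), (∀ j, α j ≠ 0) ∧
      ∀ x : ℝ, ∑ j, c j * max (α j * x + β j) 0 ^ k =
        ∑ j ∈ range N, d j * cardinalBSpline k (s * x + b + j) := by
  let e := (finProdFinEquiv (m := N) (n := k + 2)).symm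
  refine ⟨N * (k + 2), fun p => d (e p).1 * ((k.factorial : ℝ)⁻¹ *
    ((-1) ^ (k + 1 - ((e p).2 : ℕ)) * (k + 1).choose (e p).2)), fun _ => s,
    fun p => b + ((e p).1 : ℕ) + ((e p).2 : ℕ), fun _ => hs, fun x => ?_⟩
  rw [e.sum_comp (fun p : Fin N × Fin (k + 2) => d p.1 * ((k.factorial : ℝ)⁻¹ *
    ((-1) ^ (k + 1 - (p.2 : ℕ)) * (k + 1).choose p.2)) *
      max (s * x + (b + (p.1 : ℕ) + (p.2 : ℕ))) 0 ^ k), Fintype.sum_prod_type,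
    ← Fin.sum_univ_eq_sum_range (fun j => d j * cardinalBSpline k (s * x + b + j))]
  refine sum_congr rfl fun j _ => ?_
  rw [cardinalBSpline_eq_sum, mul_sum, ← Fin.sum_univ_eq_sum_range (fun i => d j *
    (((k.factorial : ℝ)⁻¹ * ((-1) ^ (k + 1 - i) * (k + 1).choose i)) *
      max (s * x + b + (j : ℕ) + i) 0 ^ k))]
  refine sum_congr rfl fun i _ => ?_
  simp only [mul_assoc, add_assoc]

/-- Any continuous function supported in `[−a′, a]` can be approximated uniformly on `ℝ`,
within `ε`, by a finite linear combination of functions `x ↦ ReLU^k(αx + β)` whose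
support is also contained in `[−a′, a]`. -/
theorem compactly_supported_approx_by_ReLUk (k : ℕ) (hk : 1 ≤ k)
    (a a' : ℝ) (ha : 0 < a) (ha' : 0 < a')
    (f : ℝ → ℝ) (hf_cont : Continuous f)
    (hf_supp : Function.support f ⊆ Set.Icc (-a') a)
    (ε : ℝ) (hε : 0 < ε) :
    ∃ (N : ℕ) (c α β : Fin N → ℝ), (∀ j, α j ≠ 0) ∧
      Function.support (fun x : ℝ => ∑ j, c j * max (α j * x + β j) 0 ^ k)
        ⊆ Set.Icc (-a') a ∧
      ∀ x : ℝ, |f x - ∑ j, c j * max (α j * x + β j) 0 ^ k| ≤ ε := by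
  have hk0 : k ≠ 0 := Nat.one_le_iff_ne_zero.1 hk
  have hf0 {x : ℝ} (hx : x ∉ Set.Icc (-a') a) : f x = 0 :=
    Function.notMem_support.1 fun h => hx (hf_supp h)
  obtain ⟨C, hC0, hC⟩ := exists_abs_cardinalBSpline_le hk0
  have huc : UniformContinuous f :=
    (HasCompactSupport.intro isCompact_Icc fun _ hx => hf0 hx).uniformContinuous_of_continuous
      hf_cont
  obtain ⟨η, hη, hfη⟩ := Metric.uniformContinuous_iff.1 huc (ε / ((k + 2) * C)) (by positivity)
  obtain ⟨n, hn⟩ := exists_nat_gt ((k + 1) / η)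
  have hn0 : (0 : ℝ) < n := lt_of_le_of_lt (by positivity) hn
  rw [div_lt_iff₀ hη] at hn
  obtain ⟨M, hM⟩ := exists_nat_ge (n * a + k : ℝ)
  obtain ⟨N, hN⟩ := exists_nat_ge (n * a' + M : ℝ)
  let I (j : ℕ) : Set ℝ := {x | (n : ℝ) * x + -M + j ∈ Set.Icc (-(k + 1) : ℝ) 0}
  have hdiam {j : ℕ} {x y : ℝ} (hx : x ∈ I j) (hy : y ∈ I j) :
      |f x - f y| ≤ ε / ((k + 2) * C) := by
    refine (hfη ?_).le
    rw [Real.dist_eq]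
    refine lt_of_mul_lt_mul_left (lt_of_le_of_lt ?_ hn) hn0.le
    rw [← Nat.abs_cast n, ← abs_mul, abs_le]
    constructor <;> linarith [hx.1, hx.2, hy.1, hy.2]
  -- Sample where `f` vanishes whenever the spline's support is not contained in `[-a', a]`.
  have hsample (j : ℕ) : ∃ p ∈ I j, f p ≠ 0 → I j ⊆ Set.Icc (-a') a := by
    by_cases h : I j ⊆ Set.Icc (-a') a
    · refine ⟨(M - j) / n, ?_, fun _ => h⟩
      have : (n : ℝ) * ((M - j) / n) + -M + j = 0 := by field_simp; ring
      simp only [I, Set.mem_ofPred_eq, this]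
      exact ⟨by linarith [(Nat.cast_nonneg k : (0 : ℝ) ≤ k)], le_rfl⟩
    · obtain ⟨p, hp, hp'⟩ := Set.not_subset.1 h
      exact ⟨p, hp, fun hne => absurd (hf0 hp') hne⟩
  choose p hpI hp using hsample
  obtain ⟨L, c, α, β, hα, hsum⟩ :=
    exists_sum_relu_pow_eq_sum_cardinalBSpline k N (fun j => f (p j)) hn0.ne' (-M)
  have hzero {x : ℝ} (hx : x ∉ Set.Icc (-a') a) :
      ∑ j, c j * max (α j * x + β j) 0 ^ k = 0 := by
    rw [hsum]
    refine sum_eq_zero fun j _ => ?_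
    by_cases hj : f (p j) = 0
    · rw [hj, zero_mul]
    · rw [cardinalBSpline_eq_zero hk0 fun h => hx (hp j hj h), mul_zero]
  refine ⟨L, c, α, β, hα, fun x hx => by_contra fun h => hx (hzero h), fun x => ?_⟩
  by_cases hx : x ∈ Set.Icc (-a') a
  · have h1 : (n : ℝ) * x ≤ n * a := mul_le_mul_of_nonneg_left hx.2 hn0.le
    have h2 : (n : ℝ) * -a' ≤ n * x := mul_le_mul_of_nonneg_left hx.1 hn0.le
    have hone := sum_range_cardinalBSpline_eq_one (N := N) hk0
      (y := (n : ℝ) * x + -M) (by linarith) (by linarith)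
    calc |f x - ∑ j, c j * max (α j * x + β j) 0 ^ k|
        = |∑ j ∈ range N, (f x - f (p j)) * cardinalBSpline k (n * x + -M + j)| := by
          simp only [hsum, sub_mul, sum_sub_distrib, ← mul_sum, hone, mul_one]
      _ ≤ ∑ j ∈ range N, |(f x - f (p j)) * cardinalBSpline k (n * x + -M + j)| :=
          abs_sum_le_sum_abs _ _
      _ ≤ ∑ j ∈ range N, ε / ((k + 2) * C) * |cardinalBSpline k (n * x + -M + j)| := by
          refine sum_le_sum fun j _ => ?_
          rw [abs_mul]
          by_cases hj : x ∈ I j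
          · exact mul_le_mul_of_nonneg_right (hdiam hj (hpI j)) (abs_nonneg _)
          · simp [cardinalBSpline_eq_zero hk0 hj]
      _ ≤ ε / ((k + 2) * C) * ((k + 2) * C) := by
          rw [← mul_sum]
          exact mul_le_mul_of_nonneg_left (sum_range_abs_cardinalBSpline_le hk0 hC N _)
            (by positivity)
      _ = ε := div_mul_cancel₀ _ (by positivity)
  · rw [hf0 hx, hzero hx, sub_zero, abs_zero]
    exact hε.le
end

section
/- Let k ≥ 1 be an integer. The closure of H_{ReLU^k}(ℝ) in the norm of 𝒴_k(ℝ) equals ℝ·ReLU^k_+ + ℝ·ReLU^k_− + (the closure in 𝒴_k(ℝ) of the space of compactly supported continuous functions on ℝ). That is, a function f ∈ 𝒴_k(ℝ) can be approximated in the 𝒴_k norm by finite linear combinations of functions ReLU^k(ax+b) if and only if f = β_+ ReLU^k_+ + β_− ReLU^k_− + g where β_± ∈ ℝ and g lies in the 𝒴_k-closure of C_c(ℝ). -/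
open Filter

/-- The linear span of the ridge functions `x ↦ ReLU^k(ax+b)`, `a ≠ 0`. -/
def reluPowSpan (k : ℕ) : Submodule ℝ (ℝ → ℝ) :=
  Submodule.span ℝ {F | ∃ a b : ℝ, a ≠ 0 ∧ F = fun x => max (a * x + b) 0 ^ k}

/-- The functions approximable by `reluPowSpan k` in the norm weighted by `1 + |x| ^ k`. -/
def reluPowClosure (k : ℕ) : Submodule ℝ (ℝ → ℝ) where
  carrier := {F | ∀ ε > (0 : ℝ), ∃ s ∈ reluPowSpan k, ∀ x, |F x - s x| ≤ ε * (1 + |x| ^ k)}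
  zero_mem' := fun ε hε => ⟨0, zero_mem _, fun x => by
    simp only [Pi.zero_apply, sub_zero, abs_zero]; positivity⟩
  add_mem' := by
    intro F G hF hG ε hε
    obtain ⟨s, hs, hs'⟩ := hF (ε / 2) (by positivity)
    obtain ⟨r, hr, hr'⟩ := hG (ε / 2) (by positivity)
    refine ⟨s + r, add_mem hs hr, fun x => ?_⟩
    have h : (F + G) x - (s + r) x = (F x - s x) + (G x - r x) := by
      simp only [Pi.add_apply]; ring
    rw [h]
    linarith [abs_add_le (F x - s x) (G x - r x), hs' x, hr' x]
  smul_mem' := by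
    intro c F hF ε hε
    obtain ⟨s, hs, hs'⟩ := hF (ε / (|c| + 1)) (by positivity)
    refine ⟨c • s, Submodule.smul_mem _ _ hs, fun x => ?_⟩
    have h : (c • F) x - (c • s) x = c * (F x - s x) := by
      simp only [Pi.smul_apply, smul_eq_mul]; ring
    rw [h, abs_mul]
    calc |c| * |F x - s x| ≤ (|c| + 1) * (ε / (|c| + 1) * (1 + |x| ^ k)) :=
          mul_le_mul (by linarith) (hs' x) (abs_nonneg _) (by positivity)
      _ = ε * (1 + |x| ^ k) := by field_simp

lemma mem_reluPowClosure {k : ℕ} {F : ℝ → ℝ} : F ∈ reluPowClosure k ↔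
    ∀ ε > (0 : ℝ), ∃ s ∈ reluPowSpan k, ∀ x, |F x - s x| ≤ ε * (1 + |x| ^ k) := Iff.rfl

lemma reluPowSpan_le_closure (k : ℕ) : reluPowSpan k ≤ reluPowClosure k :=
  fun F hF ε hε => ⟨F, hF, fun x => by rw [sub_self, abs_zero]; positivity⟩

/-- `reluPowClosure k` is closed under weighted uniform limits. -/
lemma mem_reluPowClosure_of_approx {k : ℕ} {F : ℝ → ℝ}
    (h : ∀ ε > (0 : ℝ), ∃ G ∈ reluPowClosure k, ∀ x, |F x - G x| ≤ ε * (1 + |x| ^ k)) :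
    F ∈ reluPowClosure k := by
  intro ε hε
  obtain ⟨G, hG, hG'⟩ := h (ε / 2) (by positivity)
  obtain ⟨s, hs, hs'⟩ := hG (ε / 2) (by positivity)
  exact ⟨s, hs, fun x => by linarith [abs_sub_le (F x) (G x) (s x), hG' x, hs' x]⟩

lemma relu_comp_mem_reluPowClosure (k : ℕ) {a : ℝ} (ha : a ≠ 0) (b : ℝ) :
    (fun x => max (a * x + b) 0 ^ k) ∈ reluPowClosure k :=
  reluPowSpan_le_closure k (Submodule.subset_span ⟨a, b, ha, rfl⟩)

lemma exists_bound_add_pow_sub (n : ℕ) : ∃ C : ℝ, 0 ≤ C ∧ ∀ b δ : ℝ, 0 ≤ b → 0 ≤ δ → δ ≤ 1 →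
    |(b + δ) ^ (n + 1) - b ^ (n + 1) - (n + 1) * δ * b ^ n| ≤ C * δ ^ 2 * (1 + b) ^ n := by
  induction n with
  | zero => exact ⟨0, le_rfl, fun b δ _ _ _ => by simp⟩
  | succ n ih =>
    obtain ⟨C, hC, h⟩ := ih
    refine ⟨C + (n + 1), by positivity, fun b δ hb hδ hδ1 => ?_⟩
    have e : (b + δ) ^ (n + 1 + 1) - b ^ (n + 1 + 1) - ((n + 1 : ℕ) + 1) * δ * b ^ (n + 1)
        = (b + δ) * ((b + δ) ^ (n + 1) - b ^ (n + 1) - (n + 1) * δ * b ^ n)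
          + (n + 1) * δ ^ 2 * b ^ n := by push_cast; ring
    have h1 : b ^ n ≤ (1 + b) ^ (n + 1) :=
      (pow_le_pow_left₀ hb (by linarith) n).trans
        (pow_le_pow_right₀ (by linarith) (Nat.le_succ n))
    rw [e]
    refine (abs_add_le _ _).trans ?_
    rw [abs_mul, abs_of_nonneg (by positivity : 0 ≤ b + δ),
      abs_of_nonneg (by positivity : 0 ≤ ((n : ℝ) + 1) * δ ^ 2 * b ^ n)]
    calc _ ≤ (1 + b) * (C * δ ^ 2 * (1 + b) ^ n) + (n + 1) * δ ^ 2 * (1 + b) ^ (n + 1) := by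
          have h2 := h b δ hb hδ hδ1
          have h3 : b + δ ≤ 1 + b := by linarith
          gcongr
      _ = _ := by ring

/-- Forward difference quotients of `ReLU^(n+2)` converge at first order. -/
lemma exists_bound_relu_pow_sub (n : ℕ) : ∃ C : ℝ, 0 ≤ C ∧ ∀ u δ : ℝ, 0 ≤ δ → δ ≤ 1 →
    |max (u + δ) 0 ^ (n + 2) - max u 0 ^ (n + 2) - (n + 2) * δ * max u 0 ^ (n + 1)|
      ≤ C * δ ^ 2 * (1 + |u|) ^ (n + 1) := by
  obtain ⟨C, hC, h⟩ := exists_bound_add_pow_sub (n + 1)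
  refine ⟨C + 1, by positivity, fun u δ hδ hδ1 => ?_⟩
  rcases le_total 0 u with hu | hu
  · rw [max_eq_left hu, max_eq_left (by linarith), abs_of_nonneg hu]
    have h' := h u δ hu hδ hδ1
    push_cast at h'
    rw [show (n : ℝ) + 1 + 1 = n + 2 by ring] at h'
    refine h'.trans ?_
    gcongr
    linarith
  · rw [max_eq_right hu]
    have h1 : max (u + δ) 0 ≤ δ := max_le (by linarith) hδ
    have h0 : 0 ≤ max (u + δ) 0 := le_max_right _ _
    simp only [ne_eq, Nat.add_eq_zero_iff, OfNat.ofNat_ne_zero, one_ne_zero, and_false,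
      not_false_eq_true, zero_pow, sub_zero, mul_zero]
    rw [abs_of_nonneg (by positivity)]
    calc max (u + δ) 0 ^ (n + 2) ≤ δ ^ (n + 2) := by gcongr
      _ ≤ δ ^ 2 := pow_le_pow_of_le_one hδ hδ1 (by omega)
      _ = 1 * δ ^ 2 * 1 := by ring
      _ ≤ (C + 1) * δ ^ 2 * (1 + |u|) ^ (n + 1) := by
          gcongr
          · linarith
          · exact one_le_pow₀ (by linarith [abs_nonneg u])

lemma one_add_abs_sub_pow_le {j k : ℕ} (hjk : j ≤ k) (t x : ℝ) :
    (1 + |x - t|) ^ j ≤ (1 + |t|) ^ k * 2 ^ k * (1 + |x| ^ k) := by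
  have h1 : 1 + |x - t| ≤ (1 + |t|) * (1 + |x|) := by
    nlinarith [abs_sub x t, abs_nonneg x, abs_nonneg t]
  have h2 : (1 + |x|) ^ k ≤ 2 ^ (k - 1) * (1 ^ k + |x| ^ k) :=
    add_pow_le zero_le_one (abs_nonneg x) k
  rw [one_pow] at h2
  calc (1 + |x - t|) ^ j ≤ (1 + |x - t|) ^ k :=
        pow_le_pow_right₀ (by linarith [abs_nonneg (x - t)]) hjk
    _ ≤ ((1 + |t|) * (1 + |x|)) ^ k := by gcongr
    _ = (1 + |t|) ^ k * (1 + |x|) ^ k := mul_pow _ _ _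
    _ ≤ (1 + |t|) ^ k * (2 ^ k * (1 + |x| ^ k)) := by
        gcongr
        refine h2.trans ?_
        gcongr
        · norm_num
        · omega
    _ = _ := by ring

lemma relu_sub_pow_mem_of_succ {k n : ℕ} (hn : n + 1 ≤ k)
    (h : ∀ t : ℝ, (fun x => max (x - t) 0 ^ (n + 2)) ∈ reluPowClosure k) (t : ℝ) :
    (fun x => max (x - t) 0 ^ (n + 1)) ∈ reluPowClosure k := by
  apply mem_reluPowClosure_of_approx
  intro ε hε
  obtain ⟨C, hC, hb⟩ := exists_bound_relu_pow_sub n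
  set D : ℝ := (1 + |t|) ^ k * 2 ^ k with hD
  have hD0 : 0 ≤ D := by positivity
  obtain ⟨δ, hδ, hδ1, hδε⟩ : ∃ δ : ℝ, 0 < δ ∧ δ ≤ 1 ∧ C * D * δ ≤ ε := by
    refine ⟨min 1 (ε / (C * D + 1)), by positivity, min_le_left _ _, ?_⟩
    calc C * D * min 1 (ε / (C * D + 1)) ≤ (C * D + 1) * (ε / (C * D + 1)) := by
          gcongr
          · linarith
          · exact min_le_right _ _
      _ = ε := by field_simp
  refine ⟨((n + 2 : ℝ) * δ)⁻¹ • ((fun x => max (x - (t - δ)) 0 ^ (n + 2))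
    - fun x => max (x - t) 0 ^ (n + 2)), Submodule.smul_mem _ _ (sub_mem (h _) (h _)),
    fun x => ?_⟩
  have e : max (x - t) 0 ^ (n + 1) - (((n + 2 : ℝ) * δ)⁻¹ •
      ((fun x => max (x - (t - δ)) 0 ^ (n + 2)) - fun x => max (x - t) 0 ^ (n + 2))) x
      = -(((n + 2 : ℝ) * δ)⁻¹ * (max (x - t + δ) 0 ^ (n + 2) - max (x - t) 0 ^ (n + 2)
        - (n + 2) * δ * max (x - t) 0 ^ (n + 1))) := by
    simp only [Pi.smul_apply, Pi.sub_apply, smul_eq_mul]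
    rw [show x - (t - δ) = x - t + δ by ring]
    field_simp
    ring
  rw [e, abs_neg, abs_mul, abs_of_pos (by positivity : 0 < ((n + 2 : ℝ) * δ)⁻¹),
    inv_mul_le_iff₀ (by positivity)]
  calc _ ≤ C * δ ^ 2 * (1 + |x - t|) ^ (n + 1) := hb _ _ hδ.le hδ1
    _ ≤ C * δ ^ 2 * (D * (1 + |x| ^ k)) := by
        gcongr
        exact one_add_abs_sub_pow_le hn t x
    _ = C * D * δ * (δ * (1 + |x| ^ k)) := by ring
    _ ≤ ε * (δ * (1 + |x| ^ k)) := by gcongr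
    _ = 1 * δ * (ε * (1 + |x| ^ k)) := by ring
    _ ≤ (n + 2) * δ * (ε * (1 + |x| ^ k)) := by
        gcongr
        linarith [(Nat.cast_nonneg n : (0 : ℝ) ≤ n)]

lemma relu_sub_mem_reluPowClosure {k : ℕ} (hk : 1 ≤ k) (t : ℝ) :
    (fun x => max (x - t) 0) ∈ reluPowClosure k := by
  have key : ∀ m n : ℕ, n + 1 + m = k → ∀ t : ℝ,
      (fun x => max (x - t) 0 ^ (n + 1)) ∈ reluPowClosure k := by
    intro m
    induction m with
    | zero =>
      rintro n rfl t
      simpa [sub_eq_add_neg] using relu_comp_mem_reluPowClosure (n + 1) one_ne_zero (-t)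
    | succ m ih =>
      intro n hn
      exact relu_sub_pow_mem_of_succ (by omega) (ih (n + 1) (by omega))
  simpa using key (k - 1) 0 (by omega) t

/-- Piecewise linear interpolation: compactly supported continuous functions are approximable. -/
lemma compactSupport_mem_reluPowClosure {k : ℕ} (hk : 1 ≤ k) {h : ℝ → ℝ} (hc : Continuous h)
    (hs : HasCompactSupport h) : h ∈ reluPowClosure k := by
  apply mem_reluPowClosure_of_approx
  intro ε hε
  obtain ⟨δ, hδ, hδh⟩ := Metric.uniformContinuous_iff.1
    (hs.uniformContinuous_of_continuous hc) ε hε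
  obtain ⟨R, hR⟩ := hs.isCompact.isBounded.subset_closedBall 0
  have hzero : ∀ x, R < |x| → h x = 0 := fun x hx => image_eq_zero_of_notMem_tsupport fun hx' => by
    have := hR hx'
    rw [mem_closedBall_zero_iff, Real.norm_eq_abs] at this
    linarith
  set η := δ / 2 with hη
  have hη0 : 0 < η := by positivity
  set S : ℝ := |R| + 1
  have hS : R < S := by linarith [le_abs_self R]
  have hS0 : 0 < S := by positivity
  have interp : ∀ n : ℕ, ∃ s ∈ reluPowClosure k, (∀ x ≤ -S + n * η, |h x - s x| ≤ ε) ∧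
      ∀ x, -S + n * η ≤ x → s x = h (-S + n * η) := by
    intro n
    induction n with
    | zero =>
      have hz : ∀ x ≤ -S, h x = 0 := fun x hx => hzero x (by
        rw [abs_of_neg (by linarith)]; linarith)
      refine ⟨0, zero_mem _, fun x hx => ?_, fun x _ => ?_⟩
      · rw [hz x (by simpa using hx)]
        simpa using hε.le
      · simp [hz (-S) le_rfl]
    | succ n ih =>
      obtain ⟨s, hsm, hs1, hs2⟩ := ih
      set p := -S + n * η with hp
      have hq : -S + ((n + 1 : ℕ) : ℝ) * η = p + η := by push_cast; ring
      rw [hq]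
      refine ⟨s + ((h (p + η) - h p) / η) • ((fun x => max (x - p) 0) -
        fun x => max (x - (p + η)) 0), add_mem hsm (Submodule.smul_mem _ _ (sub_mem
          (relu_sub_mem_reluPowClosure hk _) (relu_sub_mem_reluPowClosure hk _))),
        fun x hx => ?_, fun x hx => ?_⟩
      · simp only [Pi.add_apply, Pi.smul_apply, Pi.sub_apply, smul_eq_mul]
        rw [max_eq_right (by linarith : x - (p + η) ≤ 0), sub_zero]
        rcases le_total x p with hxp | hxp
        · rw [max_eq_right (by linarith), mul_zero, add_zero]
          exact hs1 x hxp
        · rw [max_eq_left (by linarith), hs2 x hxp]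
          have d1 : |h x - h p| < ε := hδh (by
            rw [Real.dist_eq, abs_of_nonneg (by linarith)]; linarith)
          have d2 : |h x - h (p + η)| < ε := hδh (by
            rw [Real.dist_eq, abs_of_nonpos (by linarith)]; linarith)
          set l := (x - p) / η with hl
          have hl0 : 0 ≤ l := div_nonneg (by linarith) hη0.le
          have hl1 : l ≤ 1 := (div_le_one hη0).2 (by linarith)
          have e : h x - (h p + (h (p + η) - h p) / η * (x - p))
              = (1 - l) * (h x - h p) + l * (h x - h (p + η)) := by
            rw [hl]; field_simp; ring
          rw [e]
          rw [abs_lt] at d1 d2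
          rw [abs_le]
          constructor <;> nlinarith
      · simp only [Pi.add_apply, Pi.smul_apply, Pi.sub_apply, smul_eq_mul]
        rw [max_eq_left (by linarith), max_eq_left (by linarith), hs2 x (by linarith)]
        field_simp
        ring
  obtain ⟨n, hn⟩ := exists_nat_ge (2 * S / η)
  rw [div_le_iff₀ hη0] at hn
  obtain ⟨s, hsm, hs1, hs2⟩ := interp n
  refine ⟨s, hsm, fun x => ?_⟩
  have hle : ε ≤ ε * (1 + |x| ^ k) := le_mul_of_one_le_right hε.le (by
    linarith [pow_nonneg (abs_nonneg x) k])
  refine le_trans ?_ hle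
  rcases le_total x (-S + n * η) with hx | hx
  · exact hs1 x hx
  · have hSx : ∀ y, S ≤ y → h y = 0 := fun y hy => hzero y (by
      rw [abs_of_pos (by linarith)]; linarith)
    rw [hs2 x hx, hSx x (by linarith), hSx _ (by linarith)]
    simpa using hε.le

/-- A continuous function which is negligible at infinity against `1 + |x| ^ k` is approximable
by compactly supported continuous functions. -/
lemma exists_compactSupport_approx {k : ℕ} {g : ℝ → ℝ} (hg : Continuous g) {ε : ℝ} (hε : 0 ≤ ε)
    (h : ∀ᶠ x in cocompact ℝ, |g x| ≤ ε * (1 + |x| ^ k)) :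
    ∃ h : ℝ → ℝ, Continuous h ∧ HasCompactSupport h ∧
      ∀ x, |g x - h x| ≤ ε * (1 + |x| ^ k) := by
  obtain ⟨K, hK, hKg⟩ := mem_cocompact.1 h
  obtain ⟨χ, hχ1, -, hχc, hχ01⟩ := exists_continuous_one_zero_of_isCompact hK isClosed_empty
    (Set.disjoint_empty K)
  refine ⟨fun x => χ x * g x, χ.continuous.mul hg, hχc.mul_right, fun x => ?_⟩
  obtain ⟨h0, h1⟩ := hχ01 x
  rw [show g x - χ x * g x = (1 - χ x) * g x by ring, abs_mul, abs_of_nonneg (by linarith)]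
  by_cases hx : x ∈ K
  · rw [hχ1 hx, Pi.one_apply, sub_self, zero_mul]
    positivity
  · calc (1 - χ x) * |g x| ≤ 1 * (ε * (1 + |x| ^ k)) := by
          gcongr
          · linarith
          · exact hKg hx
      _ = _ := one_mul _

lemma tendsto_one_add_abs_pow_cocompact {k : ℕ} (hk : 1 ≤ k) :
    Tendsto (fun x : ℝ => 1 + |x| ^ k) (cocompact ℝ) atTop :=
  tendsto_atTop_add_const_left _ _
    ((tendsto_pow_atTop (by omega)).comp (tendsto_norm_cocompact_atTop (E := ℝ)))

/-- A function with weighted limit `L` differs from `L * |x| ^ k` by a negligible term. -/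
lemma eventually_abs_sub_mul_pow_le {k : ℕ} (hk : 1 ≤ k) {f : ℝ → ℝ} {L : ℝ} {l : Filter ℝ}
    (hl : l ≤ cocompact ℝ) (hf : Tendsto (fun x : ℝ => f x / (1 + |x| ^ k)) l (nhds L))
    {ε : ℝ} (hε : 0 < ε) : ∀ᶠ x in l, |f x - L * |x| ^ k| ≤ ε * (1 + |x| ^ k) := by
  filter_upwards [Metric.tendsto_nhds.1 hf (ε / 2) (by positivity),
    ((tendsto_one_add_abs_pow_cocompact hk).mono_left hl).eventually_ge_atTop (|L| / (ε / 2))]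
    with x h1 h2
  have hw : 0 < 1 + |x| ^ k := by positivity
  rw [div_le_iff₀ (by positivity)] at h2
  have e : f x / (1 + |x| ^ k) - L = (f x - L * (1 + |x| ^ k)) / (1 + |x| ^ k) := by
    field_simp
  rw [Real.dist_eq, e, abs_div, abs_of_pos hw, div_lt_iff₀ hw] at h1
  calc |f x - L * |x| ^ k| = |(f x - L * (1 + |x| ^ k)) + L| := by congr 1; ring
    _ ≤ _ := by linarith [abs_add_le (f x - L * (1 + |x| ^ k)) L]

lemma iSup_div_lt_of_le {k : ℕ} {F : ℝ → ℝ} {ε : ℝ} (hε : 0 < ε)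
    (h : ∀ x, |F x| ≤ ε / 2 * (1 + |x| ^ k)) : (⨆ x : ℝ, |F x| / (1 + |x| ^ k)) < ε :=
  (ciSup_le fun x => (div_le_iff₀ (by positivity)).2 (h x)).trans_lt (half_lt_self hε)

/-- The closure of `H_{ReLU^k}(ℝ)` in the `𝒴_k`-norm equals
`ℝ·ReLU^k_+ + ℝ·ReLU^k_− + closure_{𝒴_k}(C_c(ℝ))`: a function `f ∈ 𝒴_k(ℝ)` is
approximable in the `𝒴_k`-norm by linear combinations of `ReLU^k(a·+b)` iff
`f = β₊ ReLU^k_+ + β₋ ReLU^k_− + g` with `g` in the `𝒴_k`-closure of `C_c(ℝ)`. -/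
theorem closure_HReLUk_eq_decomposition (k : ℕ) (hk : 1 ≤ k) (f : ℝ → ℝ)
    (hf_cont : Continuous f)
    (hf_top : ∃ L : ℝ, Tendsto (fun x : ℝ => f x / (1 + |x| ^ k)) atTop (nhds L))
    (hf_bot : ∃ L : ℝ, Tendsto (fun x : ℝ => f x / (1 + |x| ^ k)) atBot (nhds L)) :
    (∀ ε > (0 : ℝ), ∃ (N : ℕ) (c a b : Fin N → ℝ), (∀ j, a j ≠ 0) ∧
        (⨆ x : ℝ, |f x - ∑ j, c j * max (a j * x + b j) 0 ^ k| / (1 + |x| ^ k)) < ε)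
    ↔ ∃ (βp βm : ℝ) (g : ℝ → ℝ),
        (∀ ε > (0 : ℝ), ∃ h : ℝ → ℝ, Continuous h ∧ HasCompactSupport h ∧
          (⨆ x : ℝ, |g x - h x| / (1 + |x| ^ k)) < ε) ∧
        ∀ x : ℝ, f x = βp * max x 0 ^ k + βm * max (-x) 0 ^ k + g x := by
  obtain ⟨Lp, hLp⟩ := hf_top
  obtain ⟨Lm, hLm⟩ := hf_bot
  set g : ℝ → ℝ := fun x => f x - (Lp * max x 0 ^ k + Lm * max (-x) 0 ^ k) with hg
  have hg_cont : Continuous g := by fun_prop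
  have hk0 : k ≠ 0 := by omega
  have hg_small : ∀ ε > (0 : ℝ), ∀ᶠ x in cocompact ℝ, |g x| ≤ ε * (1 + |x| ^ k) := by
    intro ε hε
    rw [cocompact_eq_atBot_atTop, eventually_sup]
    constructor
    · filter_upwards [eventually_abs_sub_mul_pow_le hk (by
        rw [cocompact_eq_atBot_atTop]; exact le_sup_left) hLm hε, eventually_le_atBot 0]
        with x h1 h2
      simpa [hg, max_eq_right h2, max_eq_left (neg_nonneg.2 h2), hk0, abs_of_nonpos h2] using h1
    · filter_upwards [eventually_abs_sub_mul_pow_le hk (by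
        rw [cocompact_eq_atBot_atTop]; exact le_sup_right) hLp hε, eventually_ge_atTop 0]
        with x h1 h2
      simpa [hg, max_eq_left h2, max_eq_right (neg_nonpos.2 h2), hk0, abs_of_nonneg h2] using h1
  have hf_mem : f ∈ reluPowClosure k := by
    have hg_mem : g ∈ reluPowClosure k := mem_reluPowClosure_of_approx fun ε hε => by
      obtain ⟨h, hc, hs, hh⟩ := exists_compactSupport_approx hg_cont hε.le (hg_small ε hε)
      exact ⟨h, compactSupport_mem_reluPowClosure hk hc hs, hh⟩
    have hp := relu_comp_mem_reluPowClosure k one_ne_zero 0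
    have hm := relu_comp_mem_reluPowClosure k (neg_ne_zero.2 one_ne_zero) 0
    convert add_mem (add_mem (Submodule.smul_mem _ Lp hp) (Submodule.smul_mem _ Lm hm)) hg_mem
      using 1
    ext x
    simp [hg]
  refine iff_of_true (fun ε hε => ?_) ⟨Lp, Lm, g, fun ε hε => ?_, fun x => by simp [hg]⟩
  · obtain ⟨s, hs, hsf⟩ := mem_reluPowClosure.1 hf_mem (ε / 2) (half_pos hε)
    obtain ⟨N, c, F, rfl⟩ := Submodule.mem_span_set'.1 hs
    choose a b ha hF using fun j => (F j).2
    refine ⟨N, c, a, b, ha, iSup_div_lt_of_le hε fun x => ?_⟩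
    simpa [Finset.sum_apply, hF] using hsf x
  · obtain ⟨h, hc, hs, hh⟩ := exists_compactSupport_approx hg_cont (half_pos hε).le
      (hg_small _ (half_pos hε))
    exact ⟨h, hc, hs, iSup_div_lt_of_le hε hh⟩
end

section
/- Let k ≥ 1 be an integer and let a′ < a be real numbers. Then there exists a finite linear combination φ* of functions x ↦ ReLU^k(αx + β) (real coefficients, α ≠ 0, β ∈ ℝ) such that φ*(x) = 0 for all x ≤ a′ and φ*(x) = 1 for all x ≥ a. -/
/-- There is a finite linear combination of functions `x ↦ ReLU^k(αx + β)` that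
vanishes on `(−∞, a′]` and equals `1` on `[a, ∞)`. -/
theorem exists_ReLUk_combination_step (k : ℕ) (hk : 1 ≤ k) (a' a : ℝ) (h : a' < a) :
    ∃ (N : ℕ) (c α β : Fin N → ℝ), (∀ j, α j ≠ 0) ∧
      (∀ x : ℝ, x ≤ a' → ∑ j, c j * max (α j * x + β j) 0 ^ k = 0) ∧
      (∀ x : ℝ, a ≤ x → ∑ j, c j * max (α j * x + β j) 0 ^ k = 1) := by
  have hd : 0 < a - a' := sub_pos.mpr h
  have hk0 : (0 : ℝ) < k := by exact_mod_cast hk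
  have hf : (k.factorial : ℝ) ≠ 0 := by exact_mod_cast k.factorial_ne_zero
  have hlin (x : ℝ) (j : Fin (k + 1)) :
      k / (a - a') * x + (-(k * a' / (a - a')) - k + j) = k * (x - a') / (a - a') - k + j := by
    ring
  refine ⟨k + 1, fun j ↦ (-1) ^ (k - (j : ℕ)) * k.choose j / k.factorial,
    fun _ ↦ k / (a - a'), fun j ↦ -(k * a' / (a - a')) - k + j,
    fun _ ↦ (div_pos hk0 hd).ne', fun x hx ↦ ?_, fun x hx ↦ ?_⟩
  · refine Finset.sum_eq_zero fun j _ ↦ ?_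
    have hj : (j : ℝ) ≤ k := by exact_mod_cast Nat.lt_succ_iff.mp j.isLt
    have hy : k * (x - a') / (a - a') ≤ 0 :=
      div_nonpos_of_nonpos_of_nonneg
        (mul_nonpos_of_nonneg_of_nonpos hk0.le (sub_nonpos.mpr hx)) hd.le
    rw [hlin, max_eq_right (by linarith), zero_pow (by omega), mul_zero]
  · have hy : (k : ℝ) ≤ k * (x - a') / (a - a') := by
      rw [le_div_iff₀ hd]
      gcongr
    have hdiff := congrFun (fwdDiff_iter_eq_factorial (R := ℝ) (n := k))
      (k * (x - a') / (a - a') - k)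
    rw [fwdDiff_iter_eq_sum_shift, Finset.sum_range] at hdiff
    rw [← mul_left_inj' hf, Finset.sum_mul, one_mul]
    refine (Finset.sum_congr rfl fun j _ ↦ ?_).trans hdiff
    have hj : (0 : ℝ) ≤ (j : ℕ) := Nat.cast_nonneg _
    rw [hlin, max_eq_left (by linarith)]
    simp only [zsmul_eq_mul, nsmul_eq_mul, mul_one]
    push_cast
    field_simp
end

section
/- Let k ≥ 1 be an integer and let f ∈ H_{ReLU^k}(ℝ), i.e., f = Σ_{j=1}^N c_j ReLU^k(a_j · + b_j) with c_j ∈ ℝ, a_j ≠ 0, b_j ∈ ℝ. Then there exist β_+, β_− ∈ ℝ, a constant K > 0, and polynomials p, q of degree at most k − 1 such that f(x) = β_+ x^k + p(x) for all x ≥ K and f(x) = β_− (−x)^k + q(x) for all x ≤ −K. Equivalently, f − β_+ ReLU^k_+ − β_− ReLU^k_− coincides with a polynomial of degree at most k − 1 on [K, ∞) and with a (possibly different) polynomial of degree at most k − 1 on (−∞, −K]. -/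
open Polynomial in
/-- The power of an affine function is its leading monomial plus a polynomial of lower degree. -/
theorem exists_affine_pow_eq_monomial_add (k : ℕ) (a b : ℝ) :
    ∃ p : ℝ[X], p.degree < (k : WithBot ℕ) ∧
      ∀ x : ℝ, (a * x + b) ^ k = a ^ k * x ^ k + p.eval x := by
  refine ⟨(C a * X + C b) ^ k - C (a ^ k) * X ^ k, ?_, fun x => by simp⟩
  have hlin : (C a * X + C b).natDegree ≤ 1 := natDegree_linear_le
  have hpow : ((C a * X + C b) ^ k).natDegree ≤ k := by
    simpa using natDegree_pow_le_of_le k hlin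
  rw [degree_lt_iff_coeff_zero]
  intro m hm
  rcases hm.eq_or_lt with rfl | hlt
  · have h := coeff_pow_of_natDegree_le (m := k) hlin
    rw [mul_one] at h
    rw [coeff_sub, h, coeff_C_mul_X_pow, if_pos rfl]
    simp
  · rw [coeff_sub, coeff_eq_zero_of_natDegree_lt (hpow.trans_lt hlt), coeff_C_mul_X_pow,
      if_neg hlt.ne', sub_zero]

/-- Far to the right, a single `ReLU^k` unit is a multiple of `x ^ k` plus a polynomial of
degree less than `k`. -/
theorem exists_relu_pow_eq_of_le {k : ℕ} (hk : 1 ≤ k) {a : ℝ} (ha : a ≠ 0) (b : ℝ) :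
    ∃ (β K : ℝ) (p : Polynomial ℝ), p.degree < (k : WithBot ℕ) ∧
      ∀ x : ℝ, K ≤ x → max (a * x + b) 0 ^ k = β * x ^ k + p.eval x := by
  rcases ha.lt_or_gt with hneg | hpos
  · refine ⟨0, -b / a, 0, by simp, fun x hx => ?_⟩
    rw [div_le_iff_of_neg hneg] at hx
    rw [max_eq_right (by linarith), zero_pow (by omega)]
    simp
  · obtain ⟨p, hp, hpx⟩ := exists_affine_pow_eq_monomial_add k a b
    refine ⟨a ^ k, -b / a, p, hp, fun x hx => ?_⟩
    rw [div_le_iff₀ hpos] at hx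
    rw [max_eq_left (by linarith), hpx]

/-- Far to the right, a finite combination of `ReLU^k` units is a multiple of `x ^ k` plus a
polynomial of degree less than `k`. -/
theorem exists_sum_relu_pow_eq_of_le {ι : Type*} [Fintype ι] {k : ℕ} (hk : 1 ≤ k)
    (c a b : ι → ℝ) (ha : ∀ j, a j ≠ 0) :
    ∃ (β K : ℝ) (p : Polynomial ℝ), p.degree < (k : WithBot ℕ) ∧
      ∀ x : ℝ, K ≤ x → ∑ j, c j * max (a j * x + b j) 0 ^ k = β * x ^ k + p.eval x := by
  choose β K p hp hpx using fun j => exists_relu_pow_eq_of_le hk (ha j) (b j)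
  refine ⟨∑ j, c j * β j, ∑ j, |K j|, ∑ j, c j • p j, ?_, fun x hx => ?_⟩
  · rw [← Polynomial.mem_degreeLT]
    exact Submodule.sum_mem _ fun j _ =>
      Submodule.smul_mem _ _ (Polynomial.mem_degreeLT.2 (hp j))
  · rw [Polynomial.eval_finsetSum, Finset.sum_mul, ← Finset.sum_add_distrib]
    refine Finset.sum_congr rfl fun j _ => ?_
    have hK : K j ≤ x := (le_abs_self _).trans
      ((Finset.single_le_sum (f := fun i => |K i|) (fun i _ => abs_nonneg _)
        (Finset.mem_univ j)).trans hx)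
    rw [hpx j x hK, Polynomial.eval_smul, smul_eq_mul]
    ring


/-- Any `f ∈ H_{ReLU^k}(ℝ)` agrees, far to the right, with `β₊ x^k` plus a polynomial of
degree ≤ k − 1, and far to the left with `β₋ (−x)^k` plus a polynomial of degree ≤ k − 1. -/
theorem HReLUk_eventually_polynomial (k : ℕ) (hk : 1 ≤ k)
    (N : ℕ) (c a b : Fin N → ℝ) (ha : ∀ j, a j ≠ 0)
    (f : ℝ → ℝ) (hf : f = fun x => ∑ j, c j * max (a j * x + b j) 0 ^ k) :
    ∃ (βp βm K : ℝ) (p q : Polynomial ℝ), 0 < K ∧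
      p.degree < (k : WithBot ℕ) ∧ q.degree < (k : WithBot ℕ) ∧
      (∀ x : ℝ, K ≤ x → f x = βp * x ^ k + p.eval x) ∧
      (∀ x : ℝ, x ≤ -K → f x = βm * (-x) ^ k + q.eval x) := by
  obtain ⟨βp, K₁, p, hp, hpx⟩ := exists_sum_relu_pow_eq_of_le hk c a b ha
  obtain ⟨βm, K₂, q, hq, hqx⟩ :=
    exists_sum_relu_pow_eq_of_le hk c (fun j => -a j) b fun j => neg_ne_zero.2 (ha j)
  subst hf
  refine ⟨βp, βm, max 1 (max K₁ K₂), p, q.comp (-Polynomial.X), by positivity, hp, ?_,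
    fun x hx => hpx x ?_, fun x hx => ?_⟩
  · have hX : (-Polynomial.X : Polynomial ℝ).natDegree = 1 := by simp
    rcases eq_or_ne q 0 with rfl | hq0
    · simp
    · rw [← Polynomial.natDegree_lt_iff_degree_lt hq0] at hq
      refine Polynomial.degree_le_natDegree.trans_lt ?_
      rw [Polynomial.natDegree_comp, hX, mul_one]
      exact_mod_cast hq
  · exact (le_max_left _ _).trans ((le_max_right _ _).trans hx)
  · have hK : K₂ ≤ -x := by
      have := (le_max_right K₁ K₂).trans (le_max_right 1 _)
      linarith
    simpa using hqx (-x) hK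
end

section
/- Let k ≥ 1 be an integer and let σ : ℝ → ℝ be a continuous k-sigmoidal function. Then for every fixed b ∈ ℝ, sup over x ∈ ℝ and over real a with |a| ≥ 1 of |σ(ax − ab)| / (|a|^k (1 + |x|^k)) is finite; moreover, for every x ∈ ℝ, σ(ax − ab)/(|a|^k (1+|x|^k)) → max(x − b, 0)^k/(1+|x|^k) as a → +∞ and σ(ax − ab)/(|a|^k (1+|x|^k)) → max(b − x, 0)^k/(1+|x|^k) as a → −∞. -/
open Filter

/-- A continuous function with finite limits of `σ x / x ^ k` at `±∞` grows at most
like `1 + |x| ^ k`. -/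
lemma exists_abs_le_mul_one_add_abs_pow {k : ℕ} {σ : ℝ → ℝ} {l₁ l₂ : ℝ}
    (hσ_cont : Continuous σ)
    (hσ_bot : Tendsto (fun x : ℝ => σ x / x ^ k) atBot (nhds l₁))
    (hσ_top : Tendsto (fun x : ℝ => σ x / x ^ k) atTop (nhds l₂)) :
    ∃ M : ℝ, 0 ≤ M ∧ ∀ y : ℝ, |σ y| ≤ M * (1 + |y| ^ k) := by
  have growth {y c : ℝ} (hy : y ≠ 0) (h : |σ y / y ^ k| < c) : |σ y| ≤ c * (1 + |y| ^ k) := by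
    rw [abs_div, abs_pow, div_lt_iff₀ (by positivity)] at h
    have hc : 0 ≤ c := by
      by_contra! hc
      nlinarith [abs_nonneg (σ y), pow_pos (abs_pos.mpr hy) k]
    linarith
  obtain ⟨R₁, hR₁⟩ := eventually_atBot.mp (hσ_bot.abs.eventually_lt_const (lt_add_one |l₁|))
  obtain ⟨R₂, hR₂⟩ := eventually_atTop.mp (hσ_top.abs.eventually_lt_const (lt_add_one |l₂|))
  obtain ⟨B, hB⟩ := (isCompact_Icc (a := min R₁ (-1)) (b := max R₂ 1)).exists_bound_of_continuousOn
    hσ_cont.continuousOn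
  set M := max (max (|l₁| + 1) (|l₂| + 1)) B
  have h₁ : |l₁| + 1 ≤ M := (le_max_left _ _).trans (le_max_left _ _)
  have h₂ : |l₂| + 1 ≤ M := (le_max_right _ _).trans (le_max_left _ _)
  have h₃ : B ≤ M := le_max_right _ _
  have hM₀ : 0 ≤ M := by linarith [abs_nonneg l₁]
  refine ⟨M, hM₀, fun y => ?_⟩
  rcases lt_or_ge y (min R₁ (-1)) with hy | hy
  · have := lt_min_iff.mp hy
    exact growth (by linarith) ((hR₁ y this.1.le).trans_le h₁)
  rcases lt_or_ge (max R₂ 1) y with hy' | hy'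
  · have := max_lt_iff.mp hy'
    exact growth (by linarith) ((hR₂ y this.1.le).trans_le h₂)
  · have := hB y ⟨hy, hy'⟩
    rw [Real.norm_eq_abs] at this
    nlinarith [pow_nonneg (abs_nonneg y) k]

/-- Rescaling a `k`-sigmoidal function produces the truncated power `max t 0 ^ k`. -/
lemma tendsto_sigmoidal_mul_div_abs_pow {k : ℕ} (hk : 1 ≤ k) {σ : ℝ → ℝ}
    (hσ_bot : Tendsto (fun x : ℝ => σ x / x ^ k) atBot (nhds 0))
    (hσ_top : Tendsto (fun x : ℝ => σ x / x ^ k) atTop (nhds 1)) (t : ℝ) :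
    Tendsto (fun a : ℝ => σ (a * t) / |a| ^ k) atTop (nhds (max t 0 ^ k)) := by
  have hk₀ : k ≠ 0 := by omega
  have rescale (ht : t ≠ 0) :
      (fun a : ℝ => σ (a * t) / (a * t) ^ k * t ^ k) =ᶠ[atTop]
        fun a : ℝ => σ (a * t) / |a| ^ k := by
    filter_upwards [eventually_gt_atTop 0] with a ha
    rw [abs_of_pos ha, mul_pow]
    field_simp
  rcases lt_trichotomy t 0 with ht | rfl | ht
  · have := (hσ_bot.comp (tendsto_id.atTop_mul_const_of_neg ht)).mul_const (t ^ k)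
    rw [max_eq_right ht.le, zero_pow hk₀]
    rw [zero_mul] at this
    exact this.congr' (rescale ht.ne)
  · simpa [hk₀] using
      ((tendsto_pow_atTop hk₀).comp tendsto_abs_atTop_atTop).const_div_atTop (σ 0)
  · have := (hσ_top.comp (tendsto_id.atTop_mul_const ht)).mul_const (t ^ k)
    rw [max_eq_left ht.le]
    rw [one_mul] at this
    exact this.congr' (rescale ht.ne.symm)

/-- For a continuous `k`-sigmoidal `σ` and fixed `b`: the quantity
`|σ(ax − ab)| / (|a|^k (1 + |x|^k))` is uniformly bounded over `x ∈ ℝ` and `|a| ≥ 1`;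
moreover, pointwise in `x`, `σ(ax − ab)/(|a|^k(1+|x|^k))` tends to
`max(x−b,0)^k/(1+|x|^k)` as `a → +∞` and to `max(b−x,0)^k/(1+|x|^k)` as `a → −∞`. -/
theorem sigmoidal_scaled_bounded_and_limits (k : ℕ) (hk : 1 ≤ k) (σ : ℝ → ℝ)
    (hσ_cont : Continuous σ)
    (hσ_bot : Tendsto (fun x : ℝ => σ x / x ^ k) atBot (nhds 0))
    (hσ_top : Tendsto (fun x : ℝ => σ x / x ^ k) atTop (nhds 1))
    (b : ℝ) :
    (∃ C : ℝ, ∀ x a : ℝ, 1 ≤ |a| →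
      |σ (a * x - a * b)| / (|a| ^ k * (1 + |x| ^ k)) ≤ C) ∧
    (∀ x : ℝ,
      Tendsto (fun a : ℝ => σ (a * x - a * b) / (|a| ^ k * (1 + |x| ^ k))) atTop
        (nhds (max (x - b) 0 ^ k / (1 + |x| ^ k)))) ∧
    (∀ x : ℝ,
      Tendsto (fun a : ℝ => σ (a * x - a * b) / (|a| ^ k * (1 + |x| ^ k))) atBot
        (nhds (max (b - x) 0 ^ k / (1 + |x| ^ k)))) := by
  refine ⟨?_, fun x => ?_, fun x => ?_⟩
  · obtain ⟨M, hM₀, hM⟩ := exists_abs_le_mul_one_add_abs_pow hσ_cont hσ_bot hσ_top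
    refine ⟨M * (1 + 2 ^ (k - 1) * (1 + |b| ^ k)), fun x a ha => ?_⟩
    have ha_pow : 1 ≤ |a| ^ k := one_le_pow₀ ha
    rw [div_le_iff₀ (by positivity), ← mul_sub]
    have hsub : |x - b| ^ k ≤ 2 ^ (k - 1) * (|x| ^ k + |b| ^ k) :=
      (pow_le_pow_left₀ (abs_nonneg _) (abs_sub x b) k).trans
        (add_pow_le (abs_nonneg x) (abs_nonneg b) k)
    have hprod : |x| ^ k + |b| ^ k ≤ (1 + |b| ^ k) * (1 + |x| ^ k) := by
      have : 0 ≤ |b| ^ k * |x| ^ k := by positivity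
      linarith
    calc |σ (a * (x - b))| ≤ M * (1 + |a| ^ k * |x - b| ^ k) := by
          simpa [abs_mul, mul_pow] using hM (a * (x - b))
      _ ≤ M * (|a| ^ k * (1 + |x| ^ k) +
            |a| ^ k * (2 ^ (k - 1) * ((1 + |b| ^ k) * (1 + |x| ^ k)))) := by
          gcongr
          · exact one_le_mul_of_one_le_of_one_le ha_pow (by simp)
          · exact hsub.trans (by gcongr)
      _ = M * (1 + 2 ^ (k - 1) * (1 + |b| ^ k)) * (|a| ^ k * (1 + |x| ^ k)) := by ring
  · simpa only [mul_sub, div_div] using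
      (tendsto_sigmoidal_mul_div_abs_pow hk hσ_bot hσ_top (x - b)).div_const (1 + |x| ^ k)
  · refine (((tendsto_sigmoidal_mul_div_abs_pow hk hσ_bot hσ_top (b - x)).comp
      tendsto_neg_atBot_atTop).div_const (1 + |x| ^ k)).congr fun a => ?_
    rw [Function.comp_apply, abs_neg, div_div, neg_mul, ← mul_neg, neg_sub, mul_sub]
end
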